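/- The main part E̊ of a primitive extremal subset E of an Alexandrov space X is connected. -/

import Mathlib

open Metric Set

noncomputable section

namespace Collapse

/-- The comparison angle `∠̃κ` at the vertex opposite to the side of length `c` in a triangle
with side lengths `a`, `b`, `c` in the model plane of constant curvature `κ`. -/
noncomputable def cmpAngle (κ a b c : ℝ) : ℝ :=
  if κ = 0 then Real.arccos ((a ^ 2 + b ^ 2 - c ^ 2) / (2 * a * b))
  else if 0 < κ then
    Real.arccos ((Real.cos (Real.sqrt κ * c) - Real.cos (Real.sqrt κ * a) *
        Real.cos (Real.sqrt κ * b)) / (Real.sin (Real.sqrt κ * a) * Real.sin (Real.sqrt κ * b)))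
  else
    Real.arccos ((Real.cosh (Real.sqrt (-κ) * a) * Real.cosh (Real.sqrt (-κ) * b) -
        Real.cosh (Real.sqrt (-κ) * c)) /
      (Real.sinh (Real.sqrt (-κ) * a) * Real.sinh (Real.sqrt (-κ) * b)))

/-- Alexandrov's (1+3)-point comparison: curvature bounded below by `κ`. -/
def CurvGE (X : Type) [MetricSpace X] (κ : ℝ) : Prop :=
  ∀ p a b c : X, a ≠ p → b ≠ p → c ≠ p →
    cmpAngle κ (dist p a) (dist p b) (dist a b) +
      cmpAngle κ (dist p b) (dist p c) (dist b c) +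
      cmpAngle κ (dist p c) (dist p a) (dist c a) ≤ 2 * Real.pi

/-- An `n`-dimensional Alexandrov space of curvature `≥ κ`: a proper geodesic metric space
satisfying the comparison inequality, of Hausdorff dimension `n`. -/
structure IsAlexandrovSpace (X : Type) [MetricSpace X] (n : ℕ) (κ : ℝ) : Prop where
  proper : ProperSpace X
  midpoint : ∀ x y : X, ∃ m : X, dist x m = dist x y / 2 ∧ dist m y = dist x y / 2
  curv : CurvGE X κ
  dim : dimH (Set.univ : Set X) = n

/-- A pair of `μ`-approximations `θ : M → X`, `η : X → M` between metric spaces,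
with `|θ ∘ η, id_X| < μ`. -/
structure IsApproxPair {M X : Type} [MetricSpace M] [MetricSpace X] (μ : ℝ)
    (θ : M → X) (η : X → M) : Prop where
  dist_theta : ∀ a b : M, |dist (θ a) (θ b) - dist a b| < μ
  dist_eta : ∀ x y : X, |dist (η x) (η y) - dist x y| < μ
  dense_theta : ∀ x : X, ∃ a : M, dist (θ a) x < μ
  dense_eta : ∀ a : M, ∃ x : X, dist (η x) a < μ
  comp : ∀ x : X, dist (θ (η x)) x < μ

/-- `p` is a critical point of the distance function `dist_q`: the differential of `dist_q`
at `p` is nonpositive, i.e. every comparison angle `∠̃κ q p x` is at most `π/2`. -/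
def IsCriticalPt {X : Type} [MetricSpace X] (κ : ℝ) (q p : X) : Prop :=
  ∀ x : X, x ≠ p → cmpAngle κ (dist p q) (dist p x) (dist q x) ≤ Real.pi / 2

/-- A closed subset `E` is extremal: every point of `E` that is a local minimum on `E` of a
distance function `dist_q`, `q ∉ E`, is a critical point of `dist_q`. -/
def IsExtremal {X : Type} [MetricSpace X] (κ : ℝ) (E : Set X) : Prop :=
  IsClosed E ∧ ∀ q : X, q ∉ E → ∀ p ∈ E,
    IsLocalMinOn (fun x => dist q x) E p → IsCriticalPt κ q p

/-- `X` has no proper nonempty extremal subsets. -/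
def HasNoProperExtremal (X : Type) [MetricSpace X] (κ : ℝ) : Prop :=
  ∀ E : Set X, IsExtremal κ E → E = ∅ ∨ E = Set.univ

/-- The main part of an extremal subset: the complement in `E` of all proper extremal subsets. -/
def mainPart {X : Type} [MetricSpace X] (κ : ℝ) (E : Set X) : Set X :=
  E \ ⋃₀ {F : Set X | IsExtremal κ F ∧ F ⊂ E}

/-- A primitive extremal subset: an extremal subset containing no proper extremal subset with
nonempty relative interior. -/
def IsPrimitiveExtremal {X : Type} [MetricSpace X] (κ : ℝ) (E : Set X) : Prop :=
  IsExtremal κ E ∧ ∀ F : Set X, IsExtremal κ F → F ⊂ E →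
    ∀ V : Set X, IsOpen V → V ∩ E ⊆ F → V ∩ E = ∅

/-- `E` contains no proper nonempty extremal subsets. -/
def NoProperExtremalIn {X : Type} [MetricSpace X] (κ : ℝ) (E : Set X) : Prop :=
  ∀ F : Set X, IsExtremal κ F → F ⊂ E → F = ∅

end Collapse
namespace Collapse

lemma arccos_add_le {u v : ℝ} (hu1 : -1 ≤ u) (hu2 : u ≤ 1) (hv1 : -1 ≤ v) (hv2 : v ≤ 1)
    (h : Real.arccos u + Real.arccos v ≤ Real.pi) : 0 ≤ u + v := by
  by_contra hc
  have h1 : u < -v := by linarith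
  have := Real.strictAntiOn_arccos (a := u) (b := -v) ⟨hu1, hu2⟩ ⟨by linarith, by linarith⟩ h1
  rw [Real.arccos_neg] at this
  linarith

/-- hyperbolic law of cosines consequence -/
lemma hyp_core {h c x y : ℝ} (hh : 0 < h) (hc : 0 < c)
    (hx1 : |h - c| ≤ x) (hx2 : x ≤ h + c) (hy1 : |h - c| ≤ y) (hy2 : y ≤ h + c)
    (H : Real.arccos ((Real.cosh h * Real.cosh c - Real.cosh x) / (Real.sinh h * Real.sinh c)) +
      Real.arccos ((Real.cosh c * Real.cosh h - Real.cosh y) / (Real.sinh c * Real.sinh h))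
        ≤ Real.pi) :
    Real.cosh x + Real.cosh y ≤ 2 * Real.cosh h * Real.cosh c := by
  have s1 : 0 < Real.sinh h := Real.sinh_pos_iff.2 hh
  have s2 : 0 < Real.sinh c := Real.sinh_pos_iff.2 hc
  have s3 : 0 < Real.sinh h * Real.sinh c := mul_pos s1 s2
  have key : ∀ z, |h - c| ≤ z → z ≤ h + c →
      -1 ≤ (Real.cosh h * Real.cosh c - Real.cosh z) / (Real.sinh h * Real.sinh c) ∧
      (Real.cosh h * Real.cosh c - Real.cosh z) / (Real.sinh h * Real.sinh c) ≤ 1 := by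
    intro z hz1 hz2
    have hz0 : 0 ≤ z := (abs_nonneg _).trans hz1
    have e1 : Real.cosh z ≤ Real.cosh (h + c) := by
      rw [Real.cosh_le_cosh, abs_of_nonneg hz0, abs_of_nonneg (by linarith)]; exact hz2
    have e2 : Real.cosh (h - c) ≤ Real.cosh z := by
      rw [Real.cosh_le_cosh, abs_of_nonneg hz0]; exact hz1
    rw [Real.cosh_add] at e1
    rw [Real.cosh_sub] at e2
    constructor
    · rw [le_div_iff₀ s3]; linarith
    · rw [div_le_iff₀ s3]; linarith
  have ee : (Real.cosh c * Real.cosh h - Real.cosh y) / (Real.sinh c * Real.sinh h) =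
    (Real.cosh h * Real.cosh c - Real.cosh y) / (Real.sinh h * Real.sinh c) := by
    rw [mul_comm (Real.cosh c), mul_comm (Real.sinh c)]
  rw [ee] at H
  have := arccos_add_le (key x hx1 hx2).1 (key x hx1 hx2).2 (key y hy1 hy2).1 (key y hy1 hy2).2 H
  rw [← add_div] at this
  have h4 : 0 ≤ (Real.cosh h * Real.cosh c - Real.cosh x + (Real.cosh h * Real.cosh c - Real.cosh y)) := by
    by_contra hcon
    push Not at hcon
    have := div_neg_of_neg_of_pos hcon s3
    linarith
  linarith

lemma cos_ge_of {z t : ℝ} (h1 : |t| ≤ z) (h2 : z ≤ 2 * Real.pi - |t|) : Real.cos z ≤ Real.cos t := by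
  rw [← Real.cos_abs t]
  rcases le_total z Real.pi with h | h
  · exact Real.cos_le_cos_of_nonneg_of_le_pi (abs_nonneg _) h h1
  · rw [← Real.cos_two_pi_sub z]
    exact Real.cos_le_cos_of_nonneg_of_le_pi (abs_nonneg _) (by linarith) (by linarith)

lemma sph_core {h c x y : ℝ} (s1 : 0 < Real.sin h) (s2 : 0 < Real.sin c)
    (hx1 : Real.cos x ≤ Real.cos (h - c)) (hx2 : Real.cos (h + c) ≤ Real.cos x)
    (hy1 : Real.cos y ≤ Real.cos (h - c)) (hy2 : Real.cos (h + c) ≤ Real.cos y)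
    (H : Real.arccos ((Real.cos x - Real.cos h * Real.cos c) / (Real.sin h * Real.sin c)) +
      Real.arccos ((Real.cos y - Real.cos c * Real.cos h) / (Real.sin c * Real.sin h))
        ≤ Real.pi) :
    2 * Real.cos h * Real.cos c ≤ Real.cos x + Real.cos y := by
  have s3 : 0 < Real.sin h * Real.sin c := mul_pos s1 s2
  have key : ∀ z, Real.cos z ≤ Real.cos (h - c) → Real.cos (h + c) ≤ Real.cos z →
      -1 ≤ (Real.cos z - Real.cos h * Real.cos c) / (Real.sin h * Real.sin c) ∧
      (Real.cos z - Real.cos h * Real.cos c) / (Real.sin h * Real.sin c) ≤ 1 := by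
    intro z e2 e1
    rw [Real.cos_add] at e1
    rw [Real.cos_sub] at e2
    constructor
    · rw [le_div_iff₀ s3]; linarith
    · rw [div_le_iff₀ s3]; linarith
  have ee : (Real.cos y - Real.cos c * Real.cos h) / (Real.sin c * Real.sin h) =
    (Real.cos y - Real.cos h * Real.cos c) / (Real.sin h * Real.sin c) := by
    rw [mul_comm (Real.cos c), mul_comm (Real.sin c)]
  rw [ee] at H
  have := arccos_add_le (key x hx1 hx2).1 (key x hx1 hx2).2 (key y hy1 hy2).1 (key y hy1 hy2).2 H
  rw [← add_div] at this
  have h4 : 0 ≤ (Real.cos x - Real.cos h * Real.cos c + (Real.cos y - Real.cos h * Real.cos c)) := by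
    by_contra hcon
    push Not at hcon
    have := div_neg_of_neg_of_pos hcon s3
    linarith
  linarith

lemma euc_core {h c x y : ℝ} (hh : 0 < h) (hc : 0 < c)
    (hx1 : |h - c| ≤ x) (hx2 : x ≤ h + c) (hy1 : |h - c| ≤ y) (hy2 : y ≤ h + c)
    (H : Real.arccos ((h ^ 2 + c ^ 2 - x ^ 2) / (2 * h * c)) +
      Real.arccos ((c ^ 2 + h ^ 2 - y ^ 2) / (2 * c * h)) ≤ Real.pi) :
    x ^ 2 + y ^ 2 ≤ 2 * (h ^ 2 + c ^ 2) := by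
  have s3 : 0 < 2 * h * c := by positivity
  have key : ∀ z, |h - c| ≤ z → z ≤ h + c →
      -1 ≤ (h ^ 2 + c ^ 2 - z ^ 2) / (2 * h * c) ∧
      (h ^ 2 + c ^ 2 - z ^ 2) / (2 * h * c) ≤ 1 := by
    intro z hz1 hz2
    have hz0 : 0 ≤ z := (abs_nonneg _).trans hz1
    have e1 : z ^ 2 ≤ (h + c) ^ 2 := by gcongr
    have e2 : (h - c) ^ 2 ≤ z ^ 2 := by
      rw [← sq_abs (h - c)]; gcongr
    constructor
    · rw [le_div_iff₀ s3]; nlinarith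
    · rw [div_le_iff₀ s3]; nlinarith
  have ee : (c ^ 2 + h ^ 2 - y ^ 2) / (2 * c * h) =
    (h ^ 2 + c ^ 2 - y ^ 2) / (2 * h * c) := by
    rw [mul_right_comm, add_comm (c ^ 2)]
  rw [ee] at H
  have := arccos_add_le (key x hx1 hx2).1 (key x hx1 hx2).2 (key y hy1 hy2).1 (key y hy1 hy2).2 H
  rw [← add_div] at this
  have h4 : 0 ≤ (h ^ 2 + c ^ 2 - x ^ 2 + (h ^ 2 + c ^ 2 - y ^ 2)) := by
    by_contra hcon
    push Not at hcon
    have := div_neg_of_neg_of_pos hcon s3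
    linarith
  linarith

lemma cmp_zero (a b c : ℝ) : cmpAngle 0 a b c =
    Real.arccos ((a ^ 2 + b ^ 2 - c ^ 2) / (2 * a * b)) := by simp [cmpAngle]

lemma cmp_pos {κ : ℝ} (hκ : 0 < κ) (a b c : ℝ) : cmpAngle κ a b c =
    Real.arccos ((Real.cos (Real.sqrt κ * c) - Real.cos (Real.sqrt κ * a) *
        Real.cos (Real.sqrt κ * b)) / (Real.sin (Real.sqrt κ * a) * Real.sin (Real.sqrt κ * b))) := by
  simp [cmpAngle, hκ.ne', hκ]

lemma cmp_neg {κ : ℝ} (hκ : κ < 0) (a b c : ℝ) : cmpAngle κ a b c =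
    Real.arccos ((Real.cosh (Real.sqrt (-κ) * a) * Real.cosh (Real.sqrt (-κ) * b) -
        Real.cosh (Real.sqrt (-κ) * c)) /
      (Real.sinh (Real.sqrt (-κ) * a) * Real.sinh (Real.sqrt (-κ) * b))) := by
  simp [cmpAngle, hκ.ne, hκ.le]

lemma cmp_pos_pi {κ : ℝ} (hκ : 0 < κ) {a b : ℝ} (ha : Real.sin (Real.sqrt κ * a) ≠ 0)
    (hb : Real.sin (Real.sqrt κ * b) ≠ 0) : cmpAngle κ a b (a + b) = Real.pi := by
  rw [cmp_pos hκ, Real.arccos_eq_pi, mul_add, Real.cos_add]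
  apply le_of_eq
  field_simp
  ring

lemma cmp_neg_pi {κ : ℝ} (hκ : κ < 0) {a b : ℝ} (ha : 0 < a)
    (hb : 0 < b) : cmpAngle κ a b (a + b) = Real.pi := by
  have hk : 0 < Real.sqrt (-κ) := Real.sqrt_pos.2 (by linarith)
  have s1 : 0 < Real.sinh (Real.sqrt (-κ) * a) := Real.sinh_pos_iff.2 (by positivity)
  have s2 : 0 < Real.sinh (Real.sqrt (-κ) * b) := Real.sinh_pos_iff.2 (by positivity)
  rw [cmp_neg hκ, Real.arccos_eq_pi, mul_add, Real.cosh_add]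
  apply le_of_eq
  field_simp
  ring

lemma cmp_zero_pi {a b : ℝ} (ha : 0 < a)
    (hb : 0 < b) : cmpAngle 0 a b (a + b) = Real.pi := by
  rw [cmp_zero, Real.arccos_eq_pi]
  apply le_of_eq
  field_simp
  ring

lemma tri_facts {X : Type} [MetricSpace X] (m a c : X) :
    |dist m a - dist m c| ≤ dist a c ∧ dist a c ≤ dist m a + dist m c := by
  constructor
  · rw [abs_le]
    constructor
    · linarith [dist_triangle m a c]
    · linarith [dist_triangle m c a, dist_comm a c]
  · linarith [dist_triangle a m c, dist_comm a m]

lemma mid_zero {X : Type} [MetricSpace X] (hX : CurvGE X 0) {a b c m : X}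
    (h1 : dist a m = dist a b / 2) (h2 : dist m b = dist a b / 2) :
    dist a c ^ 2 + dist b c ^ 2 ≤ 2 * (dist m a ^ 2 + dist m c ^ 2) := by
  rcases eq_or_ne a m with rfl | ha
  · have : dist a b = 0 := by simp at h1; linarith
    have : a = b := dist_eq_zero.1 this
    subst this
    simp; linarith
  have ham : 0 < dist m a := dist_pos.2 ha.symm
  have hmb : dist m b = dist m a := by rw [h2, ← h1, dist_comm]
  have hb : b ≠ m := by
    rintro rfl
    simp at hmb; exact ha hmb.symm
  rcases eq_or_ne c m with rfl | hc
  · rw [dist_comm a c, dist_comm b c, hmb]; simp; linarith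
  have hmc : 0 < dist m c := dist_pos.2 hc.symm
  have H := hX m a b c ha hb hc
  have : dist a b = dist m a + dist m b := by rw [dist_comm m a]; linarith
  rw [this, cmp_zero_pi ham (by rw [hmb]; exact ham), hmb, cmp_zero, cmp_zero] at H
  have t1 := tri_facts m a c
  have t2 := tri_facts m b c
  rw [hmb] at t2
  have := euc_core ham hmc t2.1 t2.2 t1.1 t1.2 (by rw [dist_comm c a] at H; linarith)
  linarith

lemma mid_neg {X : Type} [MetricSpace X] {κ : ℝ} (hκ : κ < 0) (hX : CurvGE X κ) {a b c m : X}
    (h1 : dist a m = dist a b / 2) (h2 : dist m b = dist a b / 2) :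
    Real.cosh (Real.sqrt (-κ) * dist a c) + Real.cosh (Real.sqrt (-κ) * dist b c) ≤
      2 * Real.cosh (Real.sqrt (-κ) * dist m a) * Real.cosh (Real.sqrt (-κ) * dist m c) := by
  have hk : 0 < Real.sqrt (-κ) := Real.sqrt_pos.2 (by linarith)
  set k := Real.sqrt (-κ) with hkdef
  rcases eq_or_ne a m with rfl | ha
  · have : dist a b = 0 := by simp at h1; linarith
    have : a = b := dist_eq_zero.1 this
    subst this
    simp; linarith
  have ham : 0 < dist m a := dist_pos.2 ha.symm
  have hmb : dist m b = dist m a := by rw [h2, ← h1, dist_comm]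
  have hb : b ≠ m := by
    rintro rfl
    simp at hmb; exact ha hmb.symm
  rcases eq_or_ne c m with rfl | hc
  · rw [dist_comm a c, dist_comm b c, hmb]; simp; linarith
  have hmc : 0 < dist m c := dist_pos.2 hc.symm
  have H := hX m a b c ha hb hc
  have : dist a b = dist m a + dist m b := by rw [dist_comm m a]; linarith
  rw [this, cmp_neg_pi hκ ham (by rw [hmb]; exact ham), hmb, cmp_neg hκ, cmp_neg hκ, ← hkdef] at H
  have t1 := tri_facts m a c
  have t2 := tri_facts m b c
  rw [hmb] at t2
  have sc : ∀ x y z : ℝ, |x - y| ≤ z → |k * x - k * y| ≤ k * z := by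
    intro x y z h
    rw [← mul_sub, abs_mul, abs_of_pos hk]; gcongr
  have sc2 : ∀ x y z : ℝ, z ≤ x + y → k * z ≤ k * x + k * y := by
    intro x y z h
    rw [← mul_add]; gcongr
  have := hyp_core (mul_pos hk ham) (mul_pos hk hmc) (sc _ _ _ t2.1) (sc2 _ _ _ t2.2)
    (sc _ _ _ t1.1) (sc2 _ _ _ t1.2) (by rw [dist_comm c a] at H; linarith)
  linarith

lemma mid_pos_small {X : Type} [MetricSpace X] {κ : ℝ} (hκ : 0 < κ) (hX : CurvGE X κ) {a b c m : X}
    (h1 : dist a m = dist a b / 2) (h2 : dist m b = dist a b / 2)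
    (s1 : Real.sqrt κ * dist m a ≤ 1) (s2 : Real.sqrt κ * dist m c ≤ 1) :
      2 * Real.cos (Real.sqrt κ * dist m a) * Real.cos (Real.sqrt κ * dist m c) ≤
    Real.cos (Real.sqrt κ * dist a c) + Real.cos (Real.sqrt κ * dist b c) := by
  have hk : 0 < Real.sqrt κ := Real.sqrt_pos.2 (by linarith)
  set k := Real.sqrt κ with hkdef
  rcases eq_or_ne a m with rfl | ha
  · have : dist a b = 0 := by simp at h1; linarith
    have : a = b := dist_eq_zero.1 this
    subst this
    simp; linarith
  have ham : 0 < dist m a := dist_pos.2 ha.symm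
  have hmb : dist m b = dist m a := by rw [h2, ← h1, dist_comm]
  have hb : b ≠ m := by
    rintro rfl
    simp at hmb; exact ha hmb.symm
  rcases eq_or_ne c m with rfl | hc
  · rw [dist_comm a c, dist_comm b c, hmb]; simp; linarith
  have hmc : 0 < dist m c := dist_pos.2 hc.symm
  have H := hX m a b c ha hb hc
  have : dist a b = dist m a + dist m b := by rw [dist_comm m a]; linarith
  have p3 := Real.pi_gt_three
  have q1 : 0 < Real.sin (k * dist m a) := Real.sin_pos_of_pos_of_lt_pi (by positivity) (by linarith)
  have q2 : 0 < Real.sin (k * dist m c) := Real.sin_pos_of_pos_of_lt_pi (by positivity) (by linarith)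
  rw [this, cmp_pos_pi hκ q1.ne' (by rw [hmb]; exact q1.ne'), hmb, cmp_pos hκ, cmp_pos hκ, ← hkdef] at H
  have t1 := tri_facts m a c
  have t2 := tri_facts m b c
  rw [hmb] at t2
  have sc : ∀ x y z : ℝ, |x - y| ≤ z → |k * x - k * y| ≤ k * z := by
    intro x y z h
    rw [← mul_sub, abs_mul, abs_of_pos hk]; gcongr
  have sc2 : ∀ x y z : ℝ, z ≤ x + y → k * z ≤ k * x + k * y := by
    intro x y z h
    rw [← mul_add]; gcongr
  have pa := mul_pos hk ham
  have pc := mul_pos hk hmc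
  have ab : |k * dist m a - k * dist m c| ≤ 1 := by rw [abs_le]; constructor <;> linarith
  have := sph_core (x := k * dist b c) (y := k * dist a c) q1 q2
    (cos_ge_of (sc _ _ _ t2.1) (by linarith [sc2 _ _ _ t2.2]))
    (Real.cos_le_cos_of_nonneg_of_le_pi (by positivity) (by linarith) (sc2 _ _ _ t2.2))
    (cos_ge_of (sc _ _ _ t1.1) (by linarith [sc2 _ _ _ t1.2]))
    (Real.cos_le_cos_of_nonneg_of_le_pi (by positivity) (by linarith) (sc2 _ _ _ t1.2))
    (by rw [dist_comm c a] at H; linarith)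
  linarith

end Collapse
namespace Collapse

lemma cosh_ge (t : ℝ) : 1 + t ^ 2 / 2 ≤ Real.cosh t := by
  have h1 : Real.cosh t = 1 + 2 * Real.sinh (t / 2) ^ 2 := by
    have := Real.cosh_two_mul (t / 2)
    have h2 := Real.cosh_sq (t / 2)
    rw [show 2 * (t / 2) = t by ring] at this
    linarith
  have h3 : (t / 2) ^ 2 ≤ Real.sinh (t / 2) ^ 2 := by
    rcases le_total 0 (t / 2) with h | h
    · have := Real.self_le_sinh_iff.2 h
      gcongr
    · have := Real.self_le_sinh_iff.2 (show 0 ≤ -(t / 2) by linarith)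
      rw [Real.sinh_neg] at this
      nlinarith
  nlinarith

lemma cosh_le {t : ℝ} (h0 : 0 ≤ t) (h1 : t ≤ 1) : Real.cosh t ≤ 1 + t ^ 2 / 2 + t ^ 4 / 4 := by
  have h2 := Real.cosh_le_exp_half_sq t
  have h3 : t ^ 2 ≤ 1 := by nlinarith
  have h4 := Real.abs_exp_sub_one_sub_id_le (x := t ^ 2 / 2) (by
    rw [abs_of_nonneg (by positivity)]; linarith)
  have h5 := (abs_le.1 h4).2
  nlinarith

lemma cos_le' {t : ℝ} (h0 : 0 ≤ t) (h1 : t ≤ 1) : Real.cos t ≤ 1 - t ^ 2 / 2 + t ^ 4 / 4 := by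
  have h4 := Real.cos_bound (x := t) (by rw [abs_of_nonneg h0]; exact h1)
  have h5 := (abs_le.1 h4).2
  rw [abs_of_nonneg h0] at h5
  have : 0 ≤ t ^ 4 := by positivity
  linarith

lemma prod_cos {A C R : ℝ} (hA : 0 ≤ A) (hC : 0 ≤ C) (hR : R ≤ 1) (hAR : A ≤ R) (hCR : C ≤ R) :
    1 - A ^ 2 / 2 - C ^ 2 / 2 ≤ Real.cos A * Real.cos C := by
  have a1 := Real.one_sub_sq_div_two_le_cos (x := A)
  have c1 := Real.one_sub_sq_div_two_le_cos (x := C)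
  have hA2 : A ^ 2 ≤ 1 := by nlinarith
  have hC2 : C ^ 2 ≤ 1 := by nlinarith
  have : (1 - A ^ 2 / 2) * (1 - C ^ 2 / 2) ≤ Real.cos A * Real.cos C := by
    apply mul_le_mul a1 c1 (by linarith) (by linarith)
  have : 0 ≤ A ^ 2 * C ^ 2 := by positivity
  nlinarith

lemma prod_cosh {A C R : ℝ} (hA : 0 ≤ A) (hC : 0 ≤ C) (hR : R ≤ 1) (hAR : A ≤ R) (hCR : C ≤ R) :
    Real.cosh A * Real.cosh C ≤ 1 + A ^ 2 / 2 + C ^ 2 / 2 + 2 * R ^ 4 := by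
  have a1 := cosh_le hA (hAR.trans hR)
  have c1 := cosh_le hC (hCR.trans hR)
  have h1 : Real.cosh A * Real.cosh C ≤ (1 + A ^ 2 / 2 + A ^ 4 / 4) * (1 + C ^ 2 / 2 + C ^ 4 / 4) :=
    mul_le_mul a1 c1 (Real.cosh_pos _).le (by positivity)
  have hA4 : A ^ 4 ≤ R ^ 4 := by gcongr
  have hC4 : C ^ 4 ≤ R ^ 4 := by gcongr
  have hA2 : A ^ 2 ≤ 1 := by nlinarith
  have hC2 : C ^ 2 ≤ 1 := by nlinarith
  have e1 : A ^ 2 * C ^ 2 ≤ R ^ 4 := by nlinarith [sq_nonneg (A ^ 2 - C ^ 2)]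
  have e2 : A ^ 4 * C ^ 2 ≤ R ^ 4 := by nlinarith [pow_nonneg hA 4]
  have e3 : A ^ 2 * C ^ 4 ≤ R ^ 4 := by nlinarith [pow_nonneg hC 4]
  have e4 : A ^ 4 * C ^ 4 ≤ R ^ 4 := by nlinarith [pow_nonneg hC 4, pow_nonneg hA 4, mul_nonneg (pow_nonneg hA 4) (sq_nonneg C)]
  nlinarith

lemma local_midpoint {X : Type} [MetricSpace X] {κ : ℝ} (hX : CurvGE X κ) :
    ∃ K : ℝ, 0 ≤ K ∧ ∃ r0 : ℝ, 0 < r0 ∧ ∀ r ≤ r0, ∀ a b c m : X,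
      dist a m = dist a b / 2 → dist m b = dist a b / 2 → dist m a ≤ r → dist a c ≤ r →
      dist b c ≤ r → dist m c ≤ r →
      (dist a c ^ 2 + dist b c ^ 2) / 2 - dist m a ^ 2 - K * r ^ 4 ≤ dist m c ^ 2 := by
  rcases lt_trichotomy κ 0 with hκ | rfl | hκ
  · have hk : 0 < Real.sqrt (-κ) := Real.sqrt_pos.2 (by linarith)
    refine ⟨4 * Real.sqrt (-κ) ^ 2, by positivity, 1 / Real.sqrt (-κ), by positivity, ?_⟩
    intro r hr a b c m h1 h2 d1 d2 d3 d4
    have H := mid_neg hκ hX (c := c) h1 h2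
    set k := Real.sqrt (-κ)
    have hkr : k * r ≤ 1 := by rw [le_div_iff₀ hk] at hr; linarith
    have P := prod_cosh (A := k * dist m a) (C := k * dist m c) (R := k * r) (by positivity)
      (by positivity) hkr (by gcongr) (by gcongr)
    have x1 := cosh_ge (k * dist a c)
    have y1 := cosh_ge (k * dist b c)
    have : k ^ 2 * ((dist a c ^ 2 + dist b c ^ 2) / 2 - dist m a ^ 2 - 4 * k ^ 2 * r ^ 4) ≤ k ^ 2 * dist m c ^ 2 := by
      nlinarith
    exact le_of_mul_le_mul_left this (by positivity)
  · refine ⟨0, le_rfl, 1, one_pos, ?_⟩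
    intro r hr a b c m h1 h2 d1 d2 d3 d4
    have H := mid_zero hX (c := c) h1 h2
    linarith
  · have hk : 0 < Real.sqrt κ := Real.sqrt_pos.2 (by linarith)
    refine ⟨Real.sqrt κ ^ 2, by positivity, 1 / Real.sqrt κ, by positivity, ?_⟩
    intro r hr a b c m h1 h2 d1 d2 d3 d4
    have hkr : Real.sqrt κ * r ≤ 1 := by rw [le_div_iff₀ hk] at hr; linarith
    have b1 : Real.sqrt κ * dist m a ≤ Real.sqrt κ * r := by gcongr
    have b2 : Real.sqrt κ * dist m c ≤ Real.sqrt κ * r := by gcongr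
    have b3 : Real.sqrt κ * dist a c ≤ Real.sqrt κ * r := by gcongr
    have b4 : Real.sqrt κ * dist b c ≤ Real.sqrt κ * r := by gcongr
    have H := mid_pos_small hκ hX (c := c) h1 h2 (by linarith) (by linarith)
    set k := Real.sqrt κ
    have P := prod_cos (A := k * dist m a) (C := k * dist m c) (R := k * r) (by positivity)
      (by positivity) hkr (by gcongr) (by gcongr)
    have x1 := cos_le' (t := k * dist a c) (by positivity) (by linarith)
    have y1 := cos_le' (t := k * dist b c) (by positivity) (by linarith)
    have x2 : (k * dist a c) ^ 4 ≤ (k * r) ^ 4 := by gcongr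
    have y2 : (k * dist b c) ^ 4 ≤ (k * r) ^ 4 := by gcongr
    have z2 : 0 ≤ (k * r) ^ 4 := by positivity
    have : k ^ 2 * ((dist a c ^ 2 + dist b c ^ 2) / 2 - dist m a ^ 2 - k ^ 2 * r ^ 4) ≤ k ^ 2 * dist m c ^ 2 := by
      nlinarith
    exact le_of_mul_le_mul_left this (by positivity)

lemma nonneg_of_div {a b : ℝ} (h : 0 ≤ a / b) (hb : 0 < b) : 0 ≤ a := by
  by_contra hcon
  push Not at hcon
  have := div_neg_of_neg_of_pos hcon hb
  linarith

lemma crit_zero {X : Type} [MetricSpace X] {y z x : X} (hc : IsCriticalPt 0 y z)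
    (hzy : z ≠ y) : dist y x ^ 2 ≤ dist z y ^ 2 + dist z x ^ 2 := by
  rcases eq_or_ne x z with rfl | hx
  · rw [dist_comm]; nlinarith [sq_nonneg (dist x x)]
  have h := hc x hx
  rw [cmp_zero, Real.arccos_le_pi_div_two] at h
  have h1 : 0 < dist z y := dist_pos.2 hzy
  have h2 : 0 < dist z x := dist_pos.2 hx.symm
  have := nonneg_of_div h (by positivity)
  linarith

lemma crit_neg {X : Type} [MetricSpace X] {κ : ℝ} (hκ : κ < 0) {y z x : X} (hc : IsCriticalPt κ y z)
    (hzy : z ≠ y) : Real.cosh (Real.sqrt (-κ) * dist y x) ≤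
      Real.cosh (Real.sqrt (-κ) * dist z y) * Real.cosh (Real.sqrt (-κ) * dist z x) := by
  have hk : 0 < Real.sqrt (-κ) := Real.sqrt_pos.2 (by linarith)
  rcases eq_or_ne x z with rfl | hx
  · rw [dist_comm]; simp
  have h := hc x hx
  rw [cmp_neg hκ, Real.arccos_le_pi_div_two] at h
  have h1 : 0 < dist z y := dist_pos.2 hzy
  have h2 : 0 < dist z x := dist_pos.2 hx.symm
  have s1 : 0 < Real.sinh (Real.sqrt (-κ) * dist z y) := Real.sinh_pos_iff.2 (by positivity)
  have s2 : 0 < Real.sinh (Real.sqrt (-κ) * dist z x) := Real.sinh_pos_iff.2 (by positivity)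
  have := nonneg_of_div h (by positivity)
  linarith

lemma crit_pos {X : Type} [MetricSpace X] {κ : ℝ} (hκ : 0 < κ) {y z x : X} (hc : IsCriticalPt κ y z)
    (hzy : z ≠ y) (s1 : Real.sqrt κ * dist z y < Real.pi) (s2 : Real.sqrt κ * dist z x < Real.pi) :
      Real.cos (Real.sqrt κ * dist z y) * Real.cos (Real.sqrt κ * dist z x) ≤
      Real.cos (Real.sqrt κ * dist y x) := by
  have hk : 0 < Real.sqrt κ := Real.sqrt_pos.2 (by linarith)
  rcases eq_or_ne x z with rfl | hx
  · rw [dist_comm]; simp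
  have h := hc x hx
  rw [cmp_pos hκ, Real.arccos_le_pi_div_two] at h
  have h1 : 0 < dist z y := dist_pos.2 hzy
  have h2 : 0 < dist z x := dist_pos.2 hx.symm
  have s1 : 0 < Real.sin (Real.sqrt κ * dist z y) :=
    Real.sin_pos_of_pos_of_lt_pi (by positivity) s1
  have s2 : 0 < Real.sin (Real.sqrt κ * dist z x) :=
    Real.sin_pos_of_pos_of_lt_pi (by positivity) s2
  have := nonneg_of_div h (by positivity)
  linarith

lemma local_crit {X : Type} [MetricSpace X] (κ : ℝ) :
    ∃ K : ℝ, 0 ≤ K ∧ ∃ r0 : ℝ, 0 < r0 ∧ ∀ r ≤ r0, ∀ y z x : X, IsCriticalPt κ y z → z ≠ y →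
      dist z y ≤ r → dist z x ≤ r → dist y x ≤ r →
      dist y x ^ 2 ≤ dist z y ^ 2 + dist z x ^ 2 + K * r ^ 4 := by
  rcases lt_trichotomy κ 0 with hκ | rfl | hκ
  · have hk : 0 < Real.sqrt (-κ) := Real.sqrt_pos.2 (by linarith)
    refine ⟨4 * Real.sqrt (-κ) ^ 2, by positivity, 1 / Real.sqrt (-κ), by positivity, ?_⟩
    intro r hr y z x hc hzy d1 d2 d3
    have H := crit_neg hκ (x := x) hc hzy
    set k := Real.sqrt (-κ)
    have hkr : k * r ≤ 1 := by rw [le_div_iff₀ hk] at hr; linarith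
    have P := prod_cosh (A := k * dist z y) (C := k * dist z x) (R := k * r) (by positivity)
      (by positivity) hkr (by gcongr) (by gcongr)
    have x1 := cosh_ge (k * dist y x)
    have : k ^ 2 * dist y x ^ 2 ≤ k ^ 2 * (dist z y ^ 2 + dist z x ^ 2 + 4 * k ^ 2 * r ^ 4) := by
      nlinarith
    exact le_of_mul_le_mul_left this (by positivity)
  · refine ⟨0, le_rfl, 1, one_pos, ?_⟩
    intro r hr y z x hc hzy d1 d2 d3
    have H := crit_zero (x := x) hc hzy
    linarith
  · have hk : 0 < Real.sqrt κ := Real.sqrt_pos.2 (by linarith)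
    refine ⟨Real.sqrt κ ^ 2, by positivity, 1 / Real.sqrt κ, by positivity, ?_⟩
    intro r hr y z x hc hzy d1 d2 d3
    have hkr : Real.sqrt κ * r ≤ 1 := by rw [le_div_iff₀ hk] at hr; linarith
    have b1 : Real.sqrt κ * dist z y ≤ Real.sqrt κ * r := by gcongr
    have b2 : Real.sqrt κ * dist z x ≤ Real.sqrt κ * r := by gcongr
    have b3 : Real.sqrt κ * dist y x ≤ Real.sqrt κ * r := by gcongr
    have H := crit_pos hκ (x := x) hc hzy (by linarith [Real.pi_gt_three])
      (by linarith [Real.pi_gt_three])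
    set k := Real.sqrt κ
    have P := prod_cos (A := k * dist z y) (C := k * dist z x) (R := k * r) (by positivity)
      (by positivity) hkr (by gcongr) (by gcongr)
    have x1 := cos_le' (t := k * dist y x) (by positivity) (by linarith)
    have x2 : (k * dist y x) ^ 4 ≤ (k * r) ^ 4 := by gcongr
    have z2 : 0 ≤ (k * r) ^ 4 := by positivity
    have : k ^ 2 * dist y x ^ 2 ≤ k ^ 2 * (dist z y ^ 2 + dist z x ^ 2 + k ^ 2 * r ^ 4) := by
      nlinarith
    exact le_of_mul_le_mul_left this (by positivity)

end Collapse
namespace Collapse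

def IsHalf {X : Type} [MetricSpace X] (h : X → X → X) : Prop :=
  ∀ y z, dist y (h y z) = dist y z / 2 ∧ dist (h y z) z = dist y z / 2

lemma exists_half {X : Type} [MetricSpace X]
    (hm : ∀ x y : X, ∃ m : X, dist x m = dist x y / 2 ∧ dist m y = dist x y / 2) :
    ∃ h : X → X → X, IsHalf h := by
  choose h hh using hm
  exact ⟨h, hh⟩

lemma dist_iter {X : Type} [MetricSpace X] {h : X → X → X} (hh : IsHalf h) (y a : X) (k : ℕ) :
    dist y ((h y)^[k] a) = dist y a / 2 ^ k := by
  induction k with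
  | zero => simp
  | succ k ih =>
    rw [Function.iterate_succ_apply', (hh y _).1, ih, pow_succ]
    field_simp

lemma half_contract {X : Type} [MetricSpace X] {h : X → X → X} (hh : IsHalf h) {K r0 : ℝ}
    (hK : 0 ≤ K)
    (H : ∀ r ≤ r0, ∀ a b c m : X,
      dist a m = dist a b / 2 → dist m b = dist a b / 2 → dist m a ≤ r → dist a c ≤ r →
      dist b c ≤ r → dist m c ≤ r →
      (dist a c ^ 2 + dist b c ^ 2) / 2 - dist m a ^ 2 - K * r ^ 4 ≤ dist m c ^ 2)
    {e c : ℝ} (he : 0 < e) (her : 8 * e ≤ r0) {y a b : X} (ha : dist y a ≤ 4 * e)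
    (hb : dist y b ≤ 4 * e) (hab : e ^ 2 * (c + 40000 * K * e ^ 2) ≤ dist a b ^ 2) :
    (e / 2) ^ 2 * (c + 40000 * K * (e / 2) ^ 2) ≤ dist (h y a) (h y b) ^ 2 := by
  obtain ⟨a1, a2⟩ := hh y a
  obtain ⟨b1, b2⟩ := hh y b
  set a' := h y a
  set b' := h y b
  have ta := dist_comm a' y
  have tb := dist_comm b' y
  have t1 : dist a b ≤ 8 * e := by linarith [dist_triangle a y b, dist_comm a y]
  have t2 : dist a' b ≤ 8 * e := by linarith [dist_triangle a' y b]
  have t3 : dist b' a' ≤ 8 * e := by linarith [dist_triangle b' y a']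
  have h1 := H _ her y a b a' a1 a2 (by linarith) (by linarith) t1 t2
  have h2 := H _ her y b a' b' b1 b2 (by linarith) (by linarith) (by rw [dist_comm]; exact t2) t3
  rw [dist_comm b a', ta] at *
  rw [tb, b1] at h2
  rw [dist_comm a' b']
  nlinarith [mul_nonneg hK (pow_nonneg he.le 4)]

lemma half_contract_iter {X : Type} [MetricSpace X] {h : X → X → X} (hh : IsHalf h) {K r0 : ℝ}
    (hK : 0 ≤ K)
    (H : ∀ r ≤ r0, ∀ a b c m : X,
      dist a m = dist a b / 2 → dist m b = dist a b / 2 → dist m a ≤ r → dist a c ≤ r →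
      dist b c ≤ r → dist m c ≤ r →
      (dist a c ^ 2 + dist b c ^ 2) / 2 - dist m a ^ 2 - K * r ^ 4 ≤ dist m c ^ 2)
    {e c : ℝ} (he : 0 < e) (her : 8 * e ≤ r0) {y a b : X} (ha : dist y a ≤ 4 * e)
    (hb : dist y b ≤ 4 * e) (hab : e ^ 2 * (c + 40000 * K * e ^ 2) ≤ dist a b ^ 2) (k : ℕ) :
    (e / 2 ^ k) ^ 2 * (c + 40000 * K * (e / 2 ^ k) ^ 2) ≤
      dist ((h y)^[k] a) ((h y)^[k] b) ^ 2 := by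
  induction k with
  | zero => simpa using hab
  | succ k ih =>
    have e2 : e / 2 ^ (k + 1) = e / 2 ^ k / 2 := by rw [pow_succ]; field_simp
    rw [Function.iterate_succ_apply', Function.iterate_succ_apply', e2]
    have hle : e / 2 ^ k ≤ e := div_le_self he.le (one_le_pow₀ (by norm_num))
    apply half_contract hh hK H (by positivity) (by linarith) _ _ ih
    · rw [dist_iter hh, mul_div_assoc']; gcongr
    · rw [dist_iter hh, mul_div_assoc']; gcongr

set_option maxHeartbeats 2000000 in
lemma packing {X : Type} [MetricSpace X] {κ : ℝ} {h : X → X → X} (hh : IsHalf h) {K r0 : ℝ}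
    (hK : 0 ≤ K) (hr0 : 0 < r0)
    (H : ∀ r ≤ r0, ∀ a b c m : X,
      dist a m = dist a b / 2 → dist m b = dist a b / 2 → dist m a ≤ r → dist a c ≤ r →
      dist b c ≤ r → dist m c ≤ r →
      (dist a c ^ 2 + dist b c ^ 2) / 2 - dist m a ^ 2 - K * r ^ 4 ≤ dist m c ^ 2)
    {y : X} (hy : ∀ ε > 0, ∃ z, 0 < dist y z ∧ dist y z < ε ∧ IsCriticalPt κ y z) (N : ℕ) :
    ∀ ε > 0, ∃ e, 0 < e ∧ e < ε ∧ ∃ w : Fin N → X, (∀ i, e ≤ dist y (w i) ∧ dist y (w i) ≤ 2 * e) ∧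
      ∀ i j, i ≠ j → e ^ 2 * (1 / 2 + 40000 * K * e ^ 2) ≤ dist (w i) (w j) ^ 2 := by
  obtain ⟨K2, hK2, r2, hr2, H2⟩ := local_crit (X := X) κ
  induction N with
  | zero =>
    intro ε hε
    exact ⟨ε / 2, by linarith, by linarith, Fin.elim0, fun i => i.elim0, fun i => i.elim0⟩
  | succ N ih =>
    intro ε hε
    set B := 40000 * K + 4096 * (K + K2) + 1 with hB
    have hBpos : 1 ≤ B := by have : 0 ≤ 40000 * K + 4096 * (K + K2) := by positivity
                             linarith
    obtain ⟨e, he, heε, w, hw1, hw2⟩ := ih (r0 / 8) (by positivity)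
    obtain ⟨z, hz0, hz1, hzc⟩ := hy (min (min e ε) (min (min (r0 / 8) (r2 / 8)) (1 / (2 * B))))
      (by have : 0 < B := by linarith
          simp only [lt_min_iff]; refine ⟨⟨he, hε⟩, ⟨by linarith, by linarith⟩, by positivity⟩)
    simp only [lt_min_iff] at hz1
    obtain ⟨⟨z1, z2⟩, ⟨z3, z4⟩, z5⟩ := hz1
    obtain ⟨n, hn1, hn2⟩ := exists_nat_pow_near_of_lt_one (x := dist y z / e) (y := (1 / 2 : ℝ))
      (by positivity) (by rw [div_le_one he]; exact z1.le) (by norm_num) (by norm_num)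
    rw [lt_div_iff₀ he] at hn1
    rw [div_le_iff₀ he] at hn2
    have e1eq : (1 / 2 : ℝ) ^ (n + 1) * e = e / 2 ^ (n + 1) := by
      rw [one_div, inv_pow]; field_simp
    have e2eq : (1 / 2 : ℝ) ^ n * e = 2 * (e / 2 ^ (n + 1)) := by
      rw [one_div, inv_pow, pow_succ]; field_simp
    rw [e1eq] at hn1
    rw [e2eq] at hn2
    have e3eq : e / 2 ^ n = 2 * (e / 2 ^ (n + 1)) := by
      rw [pow_succ]; field_simp
    have he'0 : 0 < e / 2 ^ (n + 1) := by positivity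
    have base : ∀ i, (e / 2 ^ (n + 1)) ^ 2 * (1 / 2 + 40000 * K * (e / 2 ^ (n + 1)) ^ 2) ≤
        dist ((h y)^[n + 1] (w i)) z ^ 2 := by
      intro i
      rw [Function.iterate_succ_apply']
      have hx := dist_iter hh y (w i) n
      set x := (h y)^[n] (w i)
      have hx1 : 2 * (e / 2 ^ (n + 1)) ≤ dist y x := by
        rw [hx, ← e3eq]; gcongr; exact (hw1 i).1
      have hx2 : dist y x ≤ 4 * (e / 2 ^ (n + 1)) := by
        rw [hx, show 4 * (e / 2 ^ (n + 1)) = 2 * e / 2 ^ n by rw [mul_div_assoc, e3eq]; ring]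
        gcongr; exact (hw1 i).2
      obtain ⟨m1, m2⟩ := hh y x
      set x1 := h y x
      set e' := e / 2 ^ (n + 1)
      have t1 : dist x1 y = dist y x / 2 := by rw [dist_comm]; exact m1
      have t2 : dist z x ≤ 8 * e' := by linarith [dist_triangle z y x, dist_comm z y]
      have t3 : dist x1 z ≤ 8 * e' := by linarith [dist_triangle x1 y z]
      have q1 := H (8 * e') (by linarith) y x z x1 m1 m2 (by linarith) (by linarith)
        (by rw [dist_comm]; exact t2) t3
      have q2 := H2 (8 * e') (by linarith) y z x hzc (by rintro rfl; simp at hz0)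
        (by rw [dist_comm]; linarith) t2 (by linarith)
      rw [dist_comm z y, dist_comm z x] at q2
      rw [t1] at q1
      have z6 : e' * (2 * B) ≤ 1 := by
        rw [lt_div_iff₀ (by linarith)] at z5
        nlinarith
      have z7 : e' ≤ 1 := by nlinarith
      have z8 : e' ^ 2 * B ≤ 1 / 2 := by nlinarith
      have z9 : e' ^ 2 * (e' ^ 2 * B) ≤ e' ^ 2 * (1 / 2) := by gcongr
      have z10 : (2 * e') ^ 2 ≤ dist y x ^ 2 := by gcongr
      rw [hB] at z9
      nlinarith [mul_nonneg hK (pow_nonneg he'0.le 4), mul_nonneg hK2 (pow_nonneg he'0.le 4), pow_nonneg he'0.le 4]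
    refine ⟨e / 2 ^ (n + 1), he'0, by linarith, Fin.cons z (fun i => (h y)^[n + 1] (w i)), ?_, ?_⟩
    · intro i
      refine Fin.cases ?_ ?_ i
      · simp only [Fin.cons_zero]; exact ⟨hn1.le, hn2⟩
      · intro i
        simp only [Fin.cons_succ]
        rw [dist_iter hh, mul_div_assoc']
        constructor
        · gcongr; exact (hw1 i).1
        · gcongr; exact (hw1 i).2
    · intro i j
      refine Fin.cases ?_ ?_ i
      · refine Fin.cases ?_ ?_ j
        · simp
        · intro j _
          simp only [Fin.cons_zero, Fin.cons_succ]
          rw [dist_comm]; exact base j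
      · intro i
        refine Fin.cases ?_ ?_ j
        · intro _
          simp only [Fin.cons_zero, Fin.cons_succ]
          exact base i
        · intro j hij
          simp only [Fin.cons_succ]
          apply half_contract_iter hh hK H he (by linarith) _ _ (hw2 i j (fun hc => hij (by rw [hc])))
          · linarith [(hw1 i).2]
          · linarith [(hw1 j).2]

end Collapse
namespace Collapse

lemma cover_lower {X : Type} [MetricSpace X] {s : ℕ} {y : X} {e : ℝ} (he : 0 < e)
    (P : ∀ x, dist x y ≤ e → ∀ k : ℕ, ∃ w : Fin (64 ^ s) → X, (∀ i, dist x (w i) ≤ 4 * (e / 2 ^ k)) ∧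
      ∀ i j, i ≠ j → (e / 2 ^ k) / 2 ≤ dist (w i) (w j))
    {ι : Type} (U : ι → Set X) (d : ι → ℝ) (hd : ∀ i, ∀ a ∈ U i, ∀ b ∈ U i, dist a b ≤ d i)
    {ρ : ℝ} (hρ : 0 < ρ) (j : ℕ) :
    ∀ (k : ℕ) (x : X) (T : Finset ι), (∀ i ∈ T, ρ ≤ d i) → e / 2 ^ k / 4 ≤ ρ * 64 ^ j →
      closedBall x (8 * (e / 2 ^ k)) ⊆ ⋃ i ∈ T, U i →
      closedBall x (8 * (e / 2 ^ k)) ⊆ closedBall y e →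
      (e / 2 ^ k / 4) ^ s ≤ ∑ i ∈ T, d i ^ s := by
  classical
  induction j with
  | zero =>
    intro k x T hT hj hcov hsub
    have hx : x ∈ ⋃ i ∈ T, U i := hcov (mem_closedBall_self (by positivity))
    simp only [mem_iUnion] at hx
    obtain ⟨i, hi, hxi⟩ := hx
    have h1 : (e / 2 ^ k / 4) ^ s ≤ d i ^ s := by
      have := hT i hi
      gcongr
      linarith
    exact h1.trans (Finset.single_le_sum (f := fun i => d i ^ s)
      (fun i hi => pow_nonneg (hρ.le.trans (hT i hi)) _) hi)
  | succ j ih =>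
    intro k x T hT hj hcov hsub
    set f := e / 2 ^ k with hf
    have hf0 : 0 < f := by positivity
    have hnn : ∀ i ∈ T, 0 ≤ d i ^ s := fun i hi => pow_nonneg (hρ.le.trans (hT i hi)) _
    by_cases hbig : ∃ i ∈ T, f / 4 ≤ d i
    · obtain ⟨i, hi, hdi⟩ := hbig
      have h1 : (f / 4) ^ s ≤ d i ^ s := by gcongr
      exact h1.trans (Finset.single_le_sum (f := fun i => d i ^ s) hnn hi)
    push Not at hbig
    have hxy : dist x y ≤ e := by
      have := hsub (mem_closedBall_self (by positivity)); simpa using this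
    obtain ⟨w, hw1, hw2⟩ := P x hxy k
    have hk6 : e / 2 ^ (k + 6) = f / 64 := by rw [hf, pow_add]; field_simp; norm_num
    let S : Fin (64 ^ s) → Finset ι := fun l =>
      T.filter (fun i => (U i ∩ closedBall (w l) (8 * (f / 64))).Nonempty)
    have hball : ∀ l, closedBall (w l) (8 * (f / 64)) ⊆ closedBall x (8 * f) := by
      intro l
      apply closedBall_subset_closedBall'
      have := hw1 l
      rw [dist_comm] at this
      linarith
    have hS : ∀ l, (f / 64 / 4) ^ s ≤ ∑ i ∈ S l, d i ^ s := by
      intro l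
      have := ih (k + 6) (w l) (S l) (fun i hi => hT i (Finset.mem_filter.1 hi).1)
      rw [hk6] at this
      apply this
      · rw [pow_succ] at hj; linarith
      · intro z hz
        have := hcov (hball l hz)
        simp only [mem_iUnion] at this ⊢
        obtain ⟨i, hi, hzi⟩ := this
        exact ⟨i, Finset.mem_filter.2 ⟨hi, z, hzi, hz⟩, hzi⟩
      · exact (hball l).trans hsub
    have hdisj : Set.PairwiseDisjoint (↑(Finset.univ : Finset (Fin (64 ^ s)))) S := by
      intro l _ l' _ hll
      rw [Function.onFun, Finset.disjoint_left]
      intro i hi hi'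
      obtain ⟨hiT, a, haU, ha⟩ := Finset.mem_filter.1 hi
      obtain ⟨_, b, hbU, hb⟩ := Finset.mem_filter.1 hi'
      have h1 := hd i a haU b hbU
      have h2 := hbig i hiT
      have h3 := hw2 l l' hll
      rw [mem_closedBall] at ha hb
      have h4 := dist_triangle4 (w l) a b (w l')
      rw [dist_comm (w l) a] at h4
      linarith
    calc (f / 4) ^ s = ∑ l : Fin (64 ^ s), (f / 64 / 4) ^ s := by
          rw [Finset.sum_const, Finset.card_univ, Fintype.card_fin, nsmul_eq_mul]
          push_cast
          rw [← mul_pow]; congr 1; field_simp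
      _ ≤ ∑ l : Fin (64 ^ s), ∑ i ∈ S l, d i ^ s := Finset.sum_le_sum (fun l _ => hS l)
      _ = ∑ i ∈ Finset.univ.biUnion S, d i ^ s := (Finset.sum_biUnion hdisj).symm
      _ ≤ ∑ i ∈ T, d i ^ s := by
          apply Finset.sum_le_sum_of_subset_of_nonneg
          · intro i hi
            obtain ⟨l, _, hl⟩ := Finset.mem_biUnion.1 hi
            exact (Finset.mem_filter.1 hl).1
          · intro i hi _
            exact hnn i hi

open MeasureTheory in
lemma exists_covers {X : Type} [MetricSpace X] {s : ℕ} (hs : 0 < s)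
    (hdim : dimH (Set.univ : Set X) < s) (C : Set X) (hC : IsCompact C) {η : ℝ} (hη : 0 < η) :
    ∃ (U : ℕ → Set X) (d : ℕ → ℝ) (T : Finset ℕ), (∀ i, 0 < d i) ∧
      (∀ i, ∀ a ∈ U i, ∀ b ∈ U i, dist a b ≤ d i) ∧ C ⊆ ⋃ i ∈ T, U i ∧
      ∑ i ∈ T, d i ^ s < η := by
  let _ : MeasurableSpace X := borel X
  have : BorelSpace X := ⟨rfl⟩
  have h0 : Measure.hausdorffMeasure (X := X) ((s : NNReal) : ℝ) Set.univ = 0 :=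
    hausdorffMeasure_of_dimH_lt (by simpa using hdim)
  have h1 : Measure.hausdorffMeasure (X := X) ((s : NNReal) : ℝ) C = 0 :=
    measure_mono_null (subset_univ _) h0
  rw [Measure.hausdorffMeasure_apply] at h1
  have h2 := (iSup_eq_bot.1 (iSup_eq_bot.1 h1 1)) one_pos
  have h3 : (⊥ : ENNReal) < ENNReal.ofReal (η / 2) := by simp [hη]
  rw [← h2] at h3
  simp only [iInf_lt_iff] at h3
  obtain ⟨t, hcov, hdiam, hsum⟩ := h3
  have hfin : ∀ i, Metric.ediam (t i) ≠ ⊤ := fun i => ((hdiam i).trans_lt (by simp)).ne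
  set a : ℕ → ℝ := fun i => (Metric.ediam (t i)).toReal with ha
  have ha0 : ∀ i, 0 ≤ a i := fun i => ENNReal.toReal_nonneg
  have hterm : ∀ i, (⨆ _ : (t i).Nonempty, Metric.ediam (t i) ^ ((s : NNReal) : ℝ)) =
      ENNReal.ofReal (a i ^ s) := by
    intro i
    have e1 : Metric.ediam (t i) ^ ((s : NNReal) : ℝ) = ENNReal.ofReal (a i ^ s) := by
      rw [ENNReal.ofReal_pow (ha0 i), ha, ENNReal.ofReal_toReal (hfin i)]
      simp
    rcases (t i).eq_empty_or_nonempty with h | h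
    · simp [h, ha, hs.ne']
    · rw [← e1]; simp [h]
  simp_rw [hterm] at hsum
  have hsumT : ∀ T : Finset ℕ, ∑ i ∈ T, a i ^ s < η / 2 := by
    intro T
    have := (ENNReal.sum_le_tsum T).trans_lt hsum
    rw [← ENNReal.ofReal_sum_of_nonneg (fun i _ => pow_nonneg (ha0 i) _)] at this
    exact (ENNReal.ofReal_lt_ofReal_iff (by positivity)).1 this
  have hex : ∀ i : ℕ, ∃ d : ℝ, a i < d ∧ d ^ s < a i ^ s + η / 2 * (1 / 2) ^ (i + 1) := by
    intro i
    have hc : ContinuousAt (fun x : ℝ => x ^ s) (a i) := by fun_prop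
    have h4 : ∀ᶠ x in nhds (a i), x ^ s < a i ^ s + η / 2 * (1 / 2) ^ (i + 1) :=
      hc.eventually_lt continuousAt_const (by simp; positivity)
    obtain ⟨δ, hδ, hball⟩ := Metric.eventually_nhds_iff.1 h4
    refine ⟨a i + δ / 2, by linarith, hball ?_⟩
    rw [Real.dist_eq]; simp only [add_sub_cancel_left]; rw [abs_of_pos (by linarith)]; linarith
  choose d hd1 hd2 using hex
  have hUcov : C ⊆ ⋃ i, Metric.thickening ((d i - a i) / 2) (t i) := by
    intro z hz
    obtain ⟨i, hi⟩ := mem_iUnion.1 (hcov hz)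
    exact mem_iUnion.2 ⟨i, Metric.self_subset_thickening (by linarith [hd1 i]) _ hi⟩
  obtain ⟨T, hT⟩ := hC.elim_finite_subcover _ (fun i => Metric.isOpen_thickening) hUcov
  refine ⟨fun i => Metric.thickening ((d i - a i) / 2) (t i), d, T,
    fun i => (ha0 i).trans_lt (hd1 i), ?_, hT, ?_⟩
  · intro i x hx y hy
    obtain ⟨x', hx', hxx⟩ := Metric.mem_thickening_iff.1 hx
    obtain ⟨y', hy', hyy⟩ := Metric.mem_thickening_iff.1 hy
    have h5 : dist x' y' ≤ a i := by
      rw [ha, dist_edist]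
      exact ENNReal.toReal_mono (hfin i) (Metric.edist_le_ediam_of_mem hx' hy')
    have h6 := dist_triangle4 x x' y' y
    rw [dist_comm y' y] at h6
    linarith
  · have h7 : ∑ i ∈ T, d i ^ s ≤ ∑ i ∈ T, (a i ^ s + η / 2 * (1 / 2) ^ (i + 1)) :=
      Finset.sum_le_sum (fun i _ => (hd2 i).le)
    rw [Finset.sum_add_distrib] at h7
    have h8 : ∑ i ∈ T, η / 2 * (1 / 2 : ℝ) ^ (i + 1) ≤ η / 2 := by
      have hs2 : HasSum (fun i : ℕ => η / 2 * (1 / 2 : ℝ) ^ (i + 1)) (η / 2) := by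
        have := (hasSum_geometric_two' (η / 2))
        convert this using 2 with i
        rw [pow_succ, one_div, inv_pow]; field_simp
      exact sum_le_hasSum T (fun i _ => by positivity) hs2
    linarith [hsumT T]

lemma dim_contra {X : Type} [MetricSpace X] [ProperSpace X] {s : ℕ} (hs : 0 < s)
    (hdim : dimH (Set.univ : Set X) < s) {y : X} {e : ℝ} (he : 0 < e)
    (P : ∀ x, dist x y ≤ e → ∀ k : ℕ, ∃ w : Fin (64 ^ s) → X, (∀ i, dist x (w i) ≤ 4 * (e / 2 ^ k)) ∧
      ∀ i j, i ≠ j → (e / 2 ^ k) / 2 ≤ dist (w i) (w j)) : False := by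
  obtain ⟨U, d, T, hd0, hd, hcov, hsum⟩ := exists_covers hs hdim (closedBall y e)
    (isCompact_closedBall y e) (η := (e / 2 ^ 3 / 4) ^ s) (by positivity)
  have hρ : ∃ ρ : ℝ, 0 < ρ ∧ ∀ i ∈ T, ρ ≤ d i := by
    rcases T.eq_empty_or_nonempty with h | h
    · exact ⟨1, one_pos, by simp [h]⟩
    · obtain ⟨i, hi, hmin⟩ := T.exists_min_image d h
      exact ⟨d i, hd0 i, hmin⟩
  obtain ⟨ρ, hρ0, hρT⟩ := hρ
  obtain ⟨j, hj⟩ := pow_unbounded_of_one_lt (e / 2 ^ 3 / 4 / ρ) (show (1 : ℝ) < 64 by norm_num)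
  rw [div_lt_iff₀ hρ0] at hj
  have h8 : 8 * (e / 2 ^ 3) = e := by ring
  have := cover_lower he P U d hd hρ0 j 3 y T hρT (by linarith) (by rw [h8]; exact hcov)
    (by rw [h8])
  linarith

theorem no_crit {X : Type} [MetricSpace X] {n : ℕ} {κ : ℝ} (hX : IsAlexandrovSpace X n κ) (y : X) :
    ∃ ε > 0, ∀ z, 0 < dist y z → dist y z < ε → ¬ IsCriticalPt κ y z := by
  by_contra hcon
  push Not at hcon
  have := hX.proper
  obtain ⟨h, hh⟩ := exists_half hX.midpoint
  obtain ⟨K, hK, r0, hr0, H⟩ := local_midpoint hX.curv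
  obtain ⟨e, he0, heε, w, hw1, hw2⟩ := packing hh hK hr0 H hcon (64 ^ (n + 1))
    (min (r0 / 8) (1 / (160000 * K + 1))) (by simp only [lt_min_iff]; constructor <;> positivity)
  rw [lt_min_iff] at heε
  obtain ⟨he1, he2⟩ := heε
  rw [lt_div_iff₀ (by positivity)] at he2
  have he3 : e ≤ 1 := by nlinarith
  have he4 : 40000 * K * e ^ 2 ≤ 1 / 4 := by nlinarith
  refine dim_contra (s := n + 1) (Nat.succ_pos _) (by rw [hX.dim]; exact_mod_cast Nat.lt_succ_self n) (y := y) he0 ?_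
  intro x hx k
  refine ⟨fun i => (h x)^[k] (w i), ?_, ?_⟩
  · intro i
    rw [dist_iter hh, mul_div_assoc']
    have := dist_triangle x y (w i)
    gcongr
    linarith [(hw1 i).2]
  · intro i j hij
    have := half_contract_iter hh hK H (c := 1 / 4) he0 (by linarith) (y := x) (a := w i) (b := w j)
      (by linarith [(hw1 i).2, dist_triangle x y (w i)])
      (by linarith [(hw1 j).2, dist_triangle x y (w j)])
      (by have := hw2 i j hij
          have h5 : 0 ≤ 40000 * K * e ^ 2 := by positivity
          have h6 : e ^ 2 * (1 / 4 + 40000 * K * e ^ 2) ≤ e ^ 2 * (1 / 2 + 40000 * K * e ^ 2) := by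
            gcongr; norm_num
          linarith) k
    set f := e / 2 ^ k
    have h7 : 0 ≤ f ^ 2 * (40000 * K * f ^ 2) := by positivity
    apply abs_le_of_sq_le_sq' _ dist_nonneg |>.2
    nlinarith

end Collapse
namespace Collapse

lemma step_zero {X : Type} [MetricSpace X] (hX : CurvGE X 0) {p q m : X}
    (h1 : dist p m = dist p q / 2) (h2 : dist m q = dist p q / 2) (hpq : p ≠ q)
    (hc : IsCriticalPt 0 m p) : IsCriticalPt 0 q p := by
  intro x hx
  have hl : 0 < dist p q := dist_pos.2 hpq
  have hs : 0 < dist p x := dist_pos.2 hx.symm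
  have hpm : p ≠ m := by
    rintro rfl
    rw [dist_self] at h1; linarith
  have c1 := crit_zero (x := x) hc hpm
  have c2 := mid_zero (c := x) hX h1 h2
  rw [cmp_zero, Real.arccos_le_pi_div_two]
  apply div_nonneg _ (by positivity)
  rw [dist_comm m p, h1] at c2
  rw [h1] at c1
  nlinarith

lemma step_neg {X : Type} [MetricSpace X] {κ : ℝ} (hκ : κ < 0) (hX : CurvGE X κ) {p q m : X}
    (h1 : dist p m = dist p q / 2) (h2 : dist m q = dist p q / 2) (hpq : p ≠ q)
    (hc : IsCriticalPt κ m p) : IsCriticalPt κ q p := by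
  intro x hx
  have hk : 0 < Real.sqrt (-κ) := Real.sqrt_pos.2 (by linarith)
  have hl : 0 < dist p q := dist_pos.2 hpq
  have hs : 0 < dist p x := dist_pos.2 hx.symm
  have hpm : p ≠ m := by
    rintro rfl
    rw [dist_self] at h1; linarith
  have c1 := crit_neg (x := x) hκ hc hpm
  have c2 := mid_neg (c := x) hκ hX h1 h2
  rw [cmp_neg hκ, Real.arccos_le_pi_div_two]
  have s1 : 0 < Real.sinh (Real.sqrt (-κ) * dist p q) := Real.sinh_pos_iff.2 (by positivity)
  have s2 : 0 < Real.sinh (Real.sqrt (-κ) * dist p x) := Real.sinh_pos_iff.2 (by positivity)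
  apply div_nonneg _ (by positivity)
  rw [dist_comm m p, h1] at c2
  rw [h1] at c1
  set k := Real.sqrt (-κ)
  have e1 := Real.cosh_two_mul (k * (dist p q / 2))
  have e2 := Real.cosh_sq (k * (dist p q / 2))
  rw [show 2 * (k * (dist p q / 2)) = k * dist p q by ring] at e1
  rw [e1]
  set C := Real.cosh (k * (dist p q / 2))
  have hC : 0 < C := Real.cosh_pos _
  have c3 := mul_le_mul_of_nonneg_left c1 hC.le
  have e3 : Real.sinh (k * (dist p q / 2)) ^ 2 = C ^ 2 - 1 := by linarith
  rw [e3]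
  linarith

lemma caseB_core {h s μ c : ℝ} (h0 : 0 < h) (h1 : h < Real.pi / 2) (s0 : 0 < s) (s1 : s < Real.pi)
    (m0 : 0 < μ) (m1 : μ < Real.pi) (t1 : |h - μ| ≤ s) (t2 : s ≤ h + μ) (t3 : |h - μ| ≤ c)
    (t4 : c ≤ h + μ) (t5 : μ ≤ h + s) (hcrit : Real.cos h * Real.cos s ≤ Real.cos μ)
    (H : Real.arccos ((Real.cos c - Real.cos h * Real.cos μ) / (Real.sin h * Real.sin μ)) +
      Real.arccos ((Real.cos s - Real.cos μ * Real.cos h) / (Real.sin μ * Real.sin h))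
        ≤ Real.pi) :
    2 * Real.cos h * Real.cos μ ≤ Real.cos c + Real.cos s := by
  have hsh : 0 < Real.sin h := Real.sin_pos_of_pos_of_lt_pi h0 (by linarith)
  have hsm : 0 < Real.sin μ := Real.sin_pos_of_pos_of_lt_pi m0 m1
  have hss : 0 < Real.sin s := Real.sin_pos_of_pos_of_lt_pi s0 s1
  have habs : |h - μ| + (h + μ) ≤ 2 * Real.pi := by
    rcases abs_cases (h - μ) with ⟨h, _⟩ | ⟨h, _⟩ <;> linarith
  have k1 : Real.cos c ≤ Real.cos (h - μ) := cos_ge_of t3 (by linarith)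
  have k2 : Real.cos s ≤ Real.cos (h - μ) := cos_ge_of t1 (by linarith)
  have hadd : Real.cos (h + s) < Real.cos h * Real.cos s := by
    rw [Real.cos_add]; nlinarith [mul_pos hsh hss]
  have k3 : Real.cos (h + μ) ≤ Real.cos s := by
    by_contra hcon
    push Not at hcon
    have : Real.cos s ≥ Real.cos (h + μ) ∨ 2 * Real.pi < h + s + μ := by
      rcases le_or_gt (h + s + μ) (2 * Real.pi) with h' | h'
      · left
        apply cos_ge_of <;> rw [abs_of_pos s0] <;> linarith
      · exact Or.inr h'
    rcases this with h' | h'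
    · linarith
    · have : Real.cos μ ≤ Real.cos (h + s) := by
        rw [← Real.cos_two_pi_sub (h + s)]
        apply Real.cos_le_cos_of_nonneg_of_le_pi <;> linarith
      linarith
  by_cases k4 : Real.cos (h + μ) ≤ Real.cos c
  · exact sph_core hsh hsm k1 k4 k2 k3 H
  · exfalso
    push Not at k4
    have e1 : (Real.cos c - Real.cos h * Real.cos μ) / (Real.sin h * Real.sin μ) ≤ -1 := by
      rw [div_le_iff₀ (by positivity)]
      rw [Real.cos_add] at k4; linarith
    rw [Real.arccos_of_le_neg_one e1] at H
    have e2 : Real.arccos ((Real.cos s - Real.cos μ * Real.cos h) / (Real.sin μ * Real.sin h)) = 0 :=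
      le_antisymm (by linarith) (Real.arccos_nonneg _)
    rw [Real.arccos_eq_zero, le_div_iff₀ (by positivity)] at e2
    have e3 : Real.cos (h - μ) ≤ Real.cos s := by rw [Real.cos_sub]; linarith
    rw [← Real.cos_abs (h - μ)] at e3
    have e4 : s ≤ |h - μ| := by
      by_contra hcon
      push Not at hcon
      have := Real.cos_lt_cos_of_nonneg_of_le_pi (abs_nonneg (h - μ)) s1.le hcon
      linarith
    rcases abs_cases (h - μ) with ⟨ha, _⟩ | ⟨ha, _⟩
    · rw [ha] at e4
      have : Real.cos (h + μ) ≤ Real.cos c := by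
        apply Real.cos_le_cos_of_nonneg_of_le_pi _ _ t4
        · linarith [abs_nonneg (h - μ)]
        · linarith
      linarith
    · rw [ha] at e4
      have : μ = h + s := by linarith
      rw [this] at hcrit
      linarith

lemma step_pos {X : Type} [MetricSpace X] {κ : ℝ} (hκ : 0 < κ) (hX : CurvGE X κ) {p q m : X}
    (h1 : dist p m = dist p q / 2) (h2 : dist m q = dist p q / 2) (hpq : p ≠ q)
    (hB : ∀ z, Real.sqrt κ * dist p z ≤ Real.pi)
    (hc : IsCriticalPt κ m p) : IsCriticalPt κ q p := by
  intro x hx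
  have hpi := Real.pi_pos
  have hk : 0 < Real.sqrt κ := Real.sqrt_pos.2 (by linarith)
  have hl : 0 < dist p q := dist_pos.2 hpq
  have hs : 0 < dist p x := dist_pos.2 hx.symm
  have hpm : p ≠ m := by
    rintro rfl
    rw [dist_self] at h1; linarith
  have hqm : q ≠ m := by
    rintro rfl
    rw [dist_self] at h2; linarith
  rw [cmp_pos hκ, Real.arccos_le_pi_div_two]
  rcases (hB q).eq_or_lt with e | e
  · rw [e]; simp
  rcases (hB x).eq_or_lt with e' | e'
  · rw [e']; simp
  have c1 := crit_pos (x := x) hκ hc hpm (by rw [h1]; nlinarith) e'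
  have T1 := tri_facts m p x
  have T2 := tri_facts m q x
  have T3 := dist_triangle m p x
  have C := hX m p q x hpm hqm
  rw [dist_comm m p] at *
  rw [h1] at c1
  have s1 : 0 < Real.sin (Real.sqrt κ * (dist p q / 2)) :=
    Real.sin_pos_of_pos_of_lt_pi (by positivity) (by nlinarith)
  have hpi' := cmp_pos_pi hκ s1.ne' s1.ne'
  rw [add_halves] at hpi'
  rw [h1, h2, hpi', dist_comm x p, cmp_pos hκ, cmp_pos hκ] at C
  rw [h1] at T1 T3
  rw [h2] at T2
  set k := Real.sqrt κ
  have sl : 0 < Real.sin (k * dist p q) := Real.sin_pos_of_pos_of_lt_pi (by positivity) e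
  have ss : 0 < Real.sin (k * dist p x) := Real.sin_pos_of_pos_of_lt_pi (by positivity) e'
  apply div_nonneg _ (by positivity)
  rcases eq_or_ne x m with rfl | hxm
  · rw [dist_comm q x, h1, h2]
    have hcc : 0 ≤ Real.cos (k * (dist p q / 2)) := Real.cos_nonneg_of_mem_Icc ⟨by nlinarith, by nlinarith⟩
    have := Real.cos_le_one (k * dist p q)
    nlinarith
  have C := C hxm
  have hmx : 0 < dist m x := dist_pos.2 hxm.symm
  have scale : ∀ {a b c : ℝ}, |a - b| ≤ c → |k * a - k * b| ≤ k * c := by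
    intro a b c h
    rw [← mul_sub, abs_mul, abs_of_pos hk]; gcongr
  have mlt : k * dist m x < Real.pi := by
    by_contra hcon
    push Not at hcon
    have a1 : Real.cos (k * dist m x) ≤ Real.cos (k * (dist p q / 2) + k * dist p x) := by
      rw [← Real.cos_two_pi_sub, ← Real.cos_two_pi_sub (k * (dist p q / 2) + k * dist p x)]
      have : k * dist m x ≤ k * (dist p q / 2) + k * dist p x := by nlinarith
      exact Real.cos_le_cos_of_nonneg_of_le_pi (by linarith) (by linarith) (by linarith)
    rw [Real.cos_add] at a1
    nlinarith [mul_pos s1 ss]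
  have core := caseB_core (h := k * (dist p q / 2)) (s := k * dist p x) (μ := k * dist m x)
    (c := k * dist q x) (by positivity) (by linarith) (by positivity) e' (by positivity) mlt
    (scale T1.1) (by nlinarith [T1.2]) (scale T2.1) (by nlinarith [T2.2]) (by nlinarith) c1
    (by linarith)
  have e1 := Real.cos_two_mul (k * (dist p q / 2))
  rw [show 2 * (k * (dist p q / 2)) = k * dist p q by ring] at e1
  rw [e1]
  have hcc : 0 ≤ Real.cos (k * (dist p q / 2)) := Real.cos_nonneg_of_mem_Icc ⟨by nlinarith, by nlinarith⟩
  have c3 := mul_le_mul_of_nonneg_left c1 hcc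
  nlinarith

end Collapse
namespace Collapse

lemma iter_dist_le {X : Type} [MetricSpace X] {h : X → X → X} (hh : IsHalf h) (y a : X) (k : ℕ) :
    dist ((h y)^[k] a) a ≤ dist y a - dist y a / 2 ^ k := by
  induction k with
  | zero => simp
  | succ k ih =>
    rw [Function.iterate_succ_apply']
    have h1 := (hh y ((h y)^[k] a)).2
    rw [dist_iter hh] at h1
    have h2 := dist_triangle (h y ((h y)^[k] a)) ((h y)^[k] a) a
    have h3 : dist y a / 2 ^ (k + 1) = dist y a / 2 ^ k / 2 := by rw [pow_succ]; field_simp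
    linarith

lemma exists_pt {X : Type} [MetricSpace X] [ProperSpace X] {h : X → X → X} (hh : IsHalf h) (x y : X)
    {t : ℝ} (t0 : 0 ≤ t) (t1 : t ≤ dist x y) : ∃ m, dist x m = t ∧ dist m y = dist x y - t := by
  set S : Set X := {m | dist x m + dist m y ≤ dist x y ∧ dist x m ≤ t} with hS
  have hSc : IsCompact S := by
    apply (isCompact_closedBall x t).of_isClosed_subset
    · apply IsClosed.inter
      · exact isClosed_le (f := fun m => dist x m + dist m y) (g := fun _ => dist x y)
          (by fun_prop) (by fun_prop)
      · exact isClosed_le (f := fun m => dist x m) (g := fun _ => t) (by fun_prop) (by fun_prop)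
    · intro m hm
      rw [mem_closedBall, dist_comm]; exact hm.2
  have hSn : S.Nonempty := ⟨x, by simp [hS, t0]⟩
  obtain ⟨m, ⟨hm1, hm2⟩, hmax⟩ := hSc.exists_isMaxOn hSn
    (f := fun m => dist x m) (by fun_prop)
  have tri := dist_triangle x m y
  refine ⟨m, ?_⟩
  have key : dist x m = t := by
    by_contra hne
    have hlt : dist x m < t := lt_of_le_of_ne hm2 hne
    have hpos : 0 < dist m y := by linarith
    obtain ⟨k, hk⟩ := pow_unbounded_of_one_lt (dist m y / (t - dist x m)) (show (1 : ℝ) < 2 by norm_num)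
    rw [div_lt_iff₀ (by linarith), mul_comm] at hk
    have hk2 : dist m y / 2 ^ k < t - dist x m := by
      rwa [div_lt_iff₀ (by positivity)]
    have e1 := dist_iter hh m y k
    have e2 := iter_dist_le hh m y k
    set z := (h m)^[k] y
    have e3 := dist_triangle x m z
    have e4 := dist_triangle x z y
    have e5 : 0 < dist m y / 2 ^ k := by positivity
    have hz : z ∈ S := ⟨by linarith, by linarith⟩
    have := hmax hz
    simp only [Set.mem_ofPred_eq] at this
    linarith
  exact ⟨key, by linarith⟩

lemma no_branch {X : Type} [MetricSpace X] {κ : ℝ} (hκ : 0 < κ) (hX : CurvGE X κ) {m a x y : X}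
    (ha : Real.sin (Real.sqrt κ * dist m a) ≠ 0) (hx : 0 < dist m x) (hy : 0 < dist m y)
    (hx1 : Real.sqrt κ * dist m x < Real.pi) (hy1 : Real.sqrt κ * dist m y < Real.pi)
    (hax : dist a x = dist m a + dist m x) (hay : dist a y = dist m a + dist m y) :
    dist x y = |dist m x - dist m y| := by
  have hk : 0 < Real.sqrt κ := Real.sqrt_pos.2 (by linarith)
  have sx : 0 < Real.sin (Real.sqrt κ * dist m x) := Real.sin_pos_of_pos_of_lt_pi (by positivity) hx1
  have sy : 0 < Real.sin (Real.sqrt κ * dist m y) := Real.sin_pos_of_pos_of_lt_pi (by positivity) hy1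
  have ham : a ≠ m := by
    rintro rfl
    simp at ha
  have C := hX m x y a (dist_pos.1 hx).symm (dist_pos.1 hy).symm ham
  rw [dist_comm y a, hay, hax, cmp_pos_pi hκ ha sx.ne', add_comm (dist m a), cmp_pos_pi hκ sy.ne' ha,
    cmp_pos hκ] at C
  have e2 : Real.arccos ((Real.cos (Real.sqrt κ * dist x y) - Real.cos (Real.sqrt κ * dist m x) *
      Real.cos (Real.sqrt κ * dist m y)) /
      (Real.sin (Real.sqrt κ * dist m x) * Real.sin (Real.sqrt κ * dist m y))) = 0 :=
    le_antisymm (by linarith) (Real.arccos_nonneg _)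
  rw [Real.arccos_eq_zero, le_div_iff₀ (by positivity)] at e2
  obtain ⟨T1, T2⟩ := tri_facts m x y
  apply le_antisymm _ T1
  by_contra hcon
  push Not at hcon
  set k := Real.sqrt κ
  have e3 : Real.cos (k * |dist m x - dist m y|) ≤ Real.cos (k * dist x y) := by
    rw [← abs_of_pos hk, ← abs_mul, Real.cos_abs, abs_of_pos hk, mul_sub, Real.cos_sub]; linarith
  have q1 : k * |dist m x - dist m y| < k * dist x y := by gcongr
  have q2 : k * dist x y ≤ k * dist m x + k * dist m y := by rw [← mul_add]; gcongr
  have q3 : k * |dist m x - dist m y| + (k * dist m x + k * dist m y) < 2 * Real.pi := by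
    rcases abs_cases (dist m x - dist m y) with ⟨h, _⟩ | ⟨h, _⟩ <;> rw [h] <;> linarith
  have q0 : 0 ≤ k * |dist m x - dist m y| := by positivity
  rcases le_total (k * dist x y) Real.pi with h | h
  · have := Real.cos_lt_cos_of_nonneg_of_le_pi q0 h q1
    linarith
  · rw [← Real.cos_two_pi_sub (k * dist x y)] at e3
    have := Real.cos_lt_cos_of_nonneg_of_le_pi q0 (y := 2 * Real.pi - k * dist x y) (by linarith) (by linarith)
    linarith

lemma lemmaM_core {h d s c : ℝ} (h0 : Real.pi / 2 < h) (d0 : 0 < d) (d1 : d < Real.pi - h)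
    (t1 : h - d ≤ s) (t2 : s ≤ h + d) (t3 : h - d ≤ c) (t4 : c ≤ h + d) (t5 : 2 * h ≤ s + c)
    (H : 2 * Real.cos h * Real.cos d ≤ Real.cos s + Real.cos c) :
    (s = h - d ∧ c = h + d) ∨ (s = h + d ∧ c = h - d) := by
  have hcs : Real.cos s + Real.cos c = 2 * Real.cos ((s + c) / 2) * Real.cos ((s - c) / 2) :=
    Real.cos_add_cos s c
  rw [hcs] at H
  have ch : Real.cos h < 0 := Real.cos_neg_of_pi_div_two_lt_of_lt h0 (by linarith)
  have cd : 0 < Real.cos d := Real.cos_pos_of_mem_Ioo ⟨by linarith, by linarith⟩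
  have hD : |(s - c) / 2| ≤ d := by rw [abs_le]; constructor <;> linarith
  have k1 : Real.cos ((s + c) / 2) ≤ Real.cos h :=
    Real.cos_le_cos_of_nonneg_of_le_pi (by linarith) (by linarith) (by linarith)
  have k2 : Real.cos d ≤ Real.cos ((s - c) / 2) := by
    rw [← Real.cos_abs ((s - c) / 2)]
    exact Real.cos_le_cos_of_nonneg_of_le_pi (abs_nonneg _) (by linarith) hD
  have k3 : |(s - c) / 2| = d := by
    by_contra hne
    have : Real.cos d < Real.cos ((s - c) / 2) := by
      rw [← Real.cos_abs ((s - c) / 2)]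
      exact Real.cos_lt_cos_of_nonneg_of_le_pi (abs_nonneg _) (by linarith) (lt_of_le_of_ne hD hne)
    nlinarith
  have k4 : (s + c) / 2 = h := by
    by_contra hne
    have h5 : h < (s + c) / 2 := lt_of_le_of_ne (by linarith) (Ne.symm hne)
    have : Real.cos ((s + c) / 2) < Real.cos h :=
      Real.cos_lt_cos_of_nonneg_of_le_pi (by linarith) (by linarith) h5
    nlinarith
  rcases abs_cases ((s - c) / 2) with ⟨h, _⟩ | ⟨h, _⟩
  · right; constructor <;> linarith
  · left; constructor <;> linarith

lemma lemmaM {X : Type} [MetricSpace X] {κ : ℝ} (hκ : 0 < κ) (hX : CurvGE X κ) {p b m x : X} {H : ℝ}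
    (hp : dist m p = H) (hb : dist m b = H) (hpb : dist p b = H + H)
    (hH : Real.pi / 2 < Real.sqrt κ * H) (d0 : 0 < dist m x)
    (d1 : Real.sqrt κ * dist m x < Real.pi - Real.sqrt κ * H) :
    (dist p x = H - dist m x ∧ dist b x = H + dist m x) ∨
      (dist p x = H + dist m x ∧ dist b x = H - dist m x) := by
  have hk : 0 < Real.sqrt κ := Real.sqrt_pos.2 (by linarith)
  have hpi := Real.pi_pos
  have hmd : 0 < Real.sqrt κ * dist m x := by positivity
  have sh : 0 < Real.sin (Real.sqrt κ * H) := Real.sin_pos_of_pos_of_lt_pi (by linarith) (by linarith)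
  have sd : 0 < Real.sin (Real.sqrt κ * dist m x) := Real.sin_pos_of_pos_of_lt_pi (by positivity) (by linarith)
  have hH0 : 0 < H := by
    by_contra hc
    push Not at hc
    have : Real.sqrt κ * H ≤ 0 := mul_nonpos_of_nonneg_of_nonpos hk.le hc
    linarith
  have C := hX m p b x (dist_pos.1 (by linarith)).symm (dist_pos.1 (by linarith)).symm (dist_pos.1 d0).symm
  rw [hp, hb, hpb, cmp_pos_pi hκ sh.ne' sh.ne', cmp_pos hκ, cmp_pos hκ, dist_comm x p] at C
  have T1 := tri_facts m p x
  have T2 := tri_facts m b x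
  have T3 := dist_triangle p x b
  rw [dist_comm x b] at T3
  rw [hp, abs_le] at T1
  rw [hb, abs_le] at T2
  set k := Real.sqrt κ
  have sc : ∀ {a b : ℝ}, a ≤ b → k * a ≤ k * b := fun h => mul_le_mul_of_nonneg_left h hk.le
  have a1 := sc T1.1.2
  have a2 := sc T1.2
  have a3 := sc T2.1.2
  have a4 := sc T2.2
  rw [hpb] at T3
  have a5 := sc T3
  rw [mul_sub] at a1 a3
  rw [mul_add] at a2 a4
  rw [mul_add, mul_add] at a5
  have b1 : ∀ z, k * H - k * dist m x ≤ z → z ≤ k * H + k * dist m x →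
      Real.cos z ≤ Real.cos (k * H - k * dist m x) := fun z h1 h2 =>
    Real.cos_le_cos_of_nonneg_of_le_pi (by linarith) (by linarith) h1
  have b2 : ∀ z, k * H - k * dist m x ≤ z → z ≤ k * H + k * dist m x →
      Real.cos (k * H + k * dist m x) ≤ Real.cos z := fun z h1 h2 =>
    Real.cos_le_cos_of_nonneg_of_le_pi (by linarith) (by linarith) h2
  have S := sph_core (x := k * dist b x) (y := k * dist p x) sh sd (b1 _ a3 a4) (b2 _ a3 a4)
    (b1 _ a1 a2) (b2 _ a1 a2) (by linarith)
  have M := lemmaM_core hH hmd d1 a1 a2 a3 a4 (by linarith) (by linarith)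
  rcases M with ⟨M1, M2⟩ | ⟨M1, M2⟩
  · left
    constructor
    · apply mul_left_cancel₀ hk.ne'; rw [M1]; ring
    · apply mul_left_cancel₀ hk.ne'; rw [M2]; ring
  · right
    constructor
    · apply mul_left_cancel₀ hk.ne'; rw [M1]; ring
    · apply mul_left_cancel₀ hk.ne'; rw [M2]; ring

lemma caseA_near {X : Type} [MetricSpace X] [ProperSpace X] {κ : ℝ} (hκ : 0 < κ) (hX : CurvGE X κ)
    {h : X → X → X} (hh : IsHalf h) {p z : X} (hz : Real.pi < Real.sqrt κ * dist p z) :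
    ∃ w : X, ∃ η > 0, p ≠ w ∧ Real.sqrt κ * dist p w < Real.pi ∧ Real.sqrt κ * η < Real.pi ∧
      ∀ x y, dist p x < η → dist p y < η → dist x y = |dist w x - dist w y| := by
  have hk : 0 < Real.sqrt κ := Real.sqrt_pos.2 (by linarith)
  have hpi := Real.pi_pos
  set k := Real.sqrt κ with hkdef
  obtain ⟨L, hL1, hL2, hL3⟩ : ∃ L, L ≤ dist p z ∧ Real.pi < k * L ∧ k * L < 2 * Real.pi := by
    rcases lt_or_ge (k * dist p z) (2 * Real.pi) with h1 | h1
    · exact ⟨_, le_rfl, hz, h1⟩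
    · refine ⟨3 * Real.pi / 2 / k, ?_, ?_, ?_⟩
      · rw [div_le_iff₀ hk]; linarith
      · rw [mul_div_cancel₀ _ hk.ne']; linarith
      · rw [mul_div_cancel₀ _ hk.ne']; linarith
  have hL0 : 0 < L := by
    by_contra hc
    push Not at hc
    have : k * L ≤ 0 := mul_nonpos_of_nonneg_of_nonpos hk.le hc
    linarith
  obtain ⟨b, hb, -⟩ := exists_pt hh p z hL0.le hL1
  obtain ⟨m1, m2⟩ := hh p b
  set m := h p b
  rw [hb] at m1 m2
  obtain ⟨H, hHdef⟩ : ∃ H, H = L / 2 := ⟨_, rfl⟩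
  have hmp : dist m p = H := by rw [dist_comm, m1, hHdef]
  have hmb : dist m b = H := by rw [m2, hHdef]
  have hpb : dist p b = H + H := by rw [hb, hHdef]; ring
  have hkH1 : Real.pi / 2 < k * H := by rw [hHdef]; linarith
  have hkH2 : k * H < Real.pi := by rw [hHdef]; linarith
  have hH0 : 0 < H := by linarith
  obtain ⟨δ, hδ⟩ : ∃ δ, δ = (Real.pi - k * H) / (2 * k) := ⟨_, rfl⟩
  have hkδ : k * δ = (Real.pi - k * H) / 2 := by rw [hδ]; field_simp
  have hδ0 : 0 < δ := by rw [hδ]; apply div_pos <;> linarith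
  have hδH : δ < H := by
    by_contra hc
    push Not at hc
    have := mul_le_mul_of_nonneg_left hc hk.le
    linarith
  obtain ⟨w, hw1, hw2⟩ := exists_pt hh m p hδ0.le (by rw [hmp]; exact hδH.le)
  rw [hmp] at hw2
  have Mw := lemmaM hκ hX (x := w) hmp hmb hpb hkH1 (by rw [hw1]; exact hδ0) (by rw [hw1, ← hkdef]; linarith)
  have hbw : dist b w = dist m b + dist m w := by
    rcases Mw with ⟨_, M⟩ | ⟨M, _⟩
    · rw [M, hmb]
    · rw [dist_comm, hw1] at M; linarith
  have sH : Real.sin (k * H) ≠ 0 := (Real.sin_pos_of_pos_of_lt_pi (by linarith) (by linarith)).ne'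
  have sδ : Real.sin (k * δ) ≠ 0 := (Real.sin_pos_of_pos_of_lt_pi (by linarith) (by linarith)).ne'
  obtain ⟨η, hη⟩ : ∃ η, η = min δ (H - δ) := ⟨_, rfl⟩
  have hη1 : η ≤ δ := by rw [hη]; exact min_le_left _ _
  have hη2 : η ≤ H - δ := by rw [hη]; exact min_le_right _ _
  have hη0 : 0 < η := by rw [hη, lt_min_iff]; constructor <;> linarith
  have hpw : dist p w = H - δ := by rw [dist_comm]; exact hw2
  have key : ∀ x, dist p x < η → dist m x = dist w m + dist w x := by
    intro x hx
    have t1 := dist_triangle m x p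
    rw [dist_comm x p, hmp] at t1
    obtain ⟨v, hv1, hv2⟩ := exists_pt hh m x hδ0.le (by linarith)
    have Mv := lemmaM hκ hX (x := v) hmp hmb hpb hkH1 (by rw [hv1]; exact hδ0) (by rw [hv1, ← hkdef]; linarith)
    have hbv : dist b v = dist m b + dist m v := by
      rcases Mv with ⟨_, M⟩ | ⟨M, _⟩
      · rw [M, hmb]
      · rw [hv1] at M
        have t2 := dist_triangle p x v
        have t3 := dist_triangle m p x
        rw [dist_comm x v] at t2
        linarith
    have := no_branch hκ hX (m := m) (a := b) (x := w) (y := v) (by rw [hmb]; exact sH)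
      (by linarith) (by linarith) (by rw [hw1, ← hkdef]; linarith) (by rw [hv1, ← hkdef]; linarith) hbw hbv
    rw [hw1, hv1, sub_self, abs_zero, dist_eq_zero] at this
    subst this
    rw [dist_comm w m, hw1, hv2]; ring
  refine ⟨w, η, hη0, ?_, ?_, ?_, ?_⟩
  · rintro rfl; rw [dist_self] at hpw; linarith
  · rw [hpw]; nlinarith
  · nlinarith
  · intro x y hx hy
    have bnd : ∀ x, dist p x < η → 0 < dist w x ∧ k * dist w x < Real.pi := by
      intro x hx
      have t1 := dist_triangle p x w
      have t2 := dist_triangle m p x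
      have t3 := key x hx
      rw [dist_comm w m] at t3
      constructor
      · rw [dist_comm x w] at t1; linarith
      · have : dist w x ≤ H := by linarith
        nlinarith
    exact no_branch hκ hX (m := w) (a := m) (by rw [dist_comm w m, hw1]; exact sδ) (bnd x hx).1 (bnd y hy).1
      (bnd x hx).2 (bnd y hy).2 (key x hx) (key y hy)

lemma caseA_ray {X : Type} [MetricSpace X] {κ : ℝ} (hκ : 0 < κ)
    {p w : X} {η : ℝ} (hpw : p ≠ w) (hw : Real.sqrt κ * dist p w < Real.pi)
    (hη : Real.sqrt κ * η < Real.pi)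
    (G : ∀ x y, dist p x < η → dist p y < η → dist x y = |dist w x - dist w y|)
    {q : X} (hq : p ≠ q) (hqη : dist p q < η) (hc : IsCriticalPt κ q p) :
    ∀ x y, dist p x < η → dist p y < η → dist x y = |dist p x - dist p y| := by
  have hk : 0 < Real.sqrt κ := Real.sqrt_pos.2 (by linarith)
  have hpi := Real.pi_pos
  have hq0 : 0 < dist p q := dist_pos.2 hq
  have hη0 : 0 < η := by linarith
  have sn : ∀ x, p ≠ x → Real.sqrt κ * dist p x < Real.pi → Real.sin (Real.sqrt κ * dist p x) ≠ 0 := by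
    intro x hx h1
    have : 0 < dist p x := dist_pos.2 hx
    exact (Real.sin_pos_of_pos_of_lt_pi (by positivity) h1).ne'
  have sq := sn q hq (by nlinarith)
  have no : ∀ x, p ≠ x → Real.sqrt κ * dist p x < Real.pi → dist q x ≠ dist p q + dist p x := by
    intro x hx h1 h2
    have := hc x hx.symm
    rw [h2, cmp_pos_pi hκ sq (sn x hx h1)] at this
    linarith
  have hp0 : dist p p < η := by simpa using hη0
  have alt : ∀ x, dist p x < η → dist w x = dist w p - dist p x ∨ dist w x = dist w p + dist p x := by
    intro x hx
    have := G p x hp0 hx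
    rcases abs_cases (dist w p - dist w x) with ⟨h, _⟩ | ⟨h, _⟩
    · left; linarith
    · right; linarith
  have hwq : dist w q = dist w p - dist p q := by
    rcases alt q hqη with h | h
    · exact h
    · exfalso
      apply no w hpw hw
      rw [dist_comm q w, h, dist_comm w p]; ring
  have hall : ∀ x, dist p x < η → dist w x = dist w p - dist p x := by
    intro x hx
    rcases alt x hx with h | h
    · exact h
    · rcases eq_or_ne p x with rfl | hpx
      · simp
      · exfalso
        apply no x hpx (by nlinarith)
        rw [G q x hqη hx, h, hwq, abs_of_nonpos] 
        · ring
        · linarith [dist_nonneg (x := p) (y := x)]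
  intro x y hx hy
  rw [G x y hx hy, hall x hx, hall y hy, abs_sub_comm]
  congr 1
  ring

lemma caseA_crit {X : Type} [MetricSpace X] [ProperSpace X] {κ : ℝ} (hκ : 0 < κ) (hX : CurvGE X κ)
    {h : X → X → X} (hh : IsHalf h) {p : X} {η : ℝ} (hη0 : 0 < η) 
    (G : ∀ x y, dist p x < η → dist p y < η → dist x y = |dist p x - dist p y|)
    {q : X} (hq : p ≠ q) : IsCriticalPt κ q p := by
  intro x hx
  have hk : 0 < Real.sqrt κ := Real.sqrt_pos.2 (by linarith)
  have hpi := Real.pi_pos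
  have hl : 0 < dist p q := dist_pos.2 hq
  have hs : 0 < dist p x := dist_pos.2 hx.symm
  rw [cmp_pos hκ, Real.arccos_le_pi_div_two]
  set k := Real.sqrt κ with hkdef
  by_cases sl : Real.sin (k * dist p q) = 0
  · rw [sl]; simp
  by_cases ss : Real.sin (k * dist p x) = 0
  · rw [ss]; simp
  let v : ℝ → ℝ := fun u => (Real.cos (k * dist q x) - Real.cos (k * (dist p q - u)) *
    Real.cos (k * (dist p x - u))) / (Real.sin (k * (dist p q - u)) * Real.sin (k * (dist p x - u)))
  have hv : ContinuousAt v 0 := by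
    apply ContinuousAt.div
    · fun_prop
    · fun_prop
    · simpa using ⟨sl, ss⟩
  have c1 : ∀ᶠ u in nhds (0 : ℝ), Real.sin (k * (dist p q - u)) ≠ 0 := by
    have : ContinuousAt (fun u => Real.sin (k * (dist p q - u))) 0 := by fun_prop
    exact this.eventually_ne (by simpa using sl)
  have c2 : ∀ᶠ u in nhds (0 : ℝ), Real.sin (k * (dist p x - u)) ≠ 0 := by
    have : ContinuousAt (fun u => Real.sin (k * (dist p x - u))) 0 := by fun_prop
    exact this.eventually_ne (by simpa using ss)
  have c3 : ∀ᶠ u in nhds (0 : ℝ), u < min (min η (Real.pi / k)) (min (dist p q) (dist p x)) :=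
    eventually_lt_nhds (by simp only [lt_min_iff]; exact ⟨⟨hη0, by positivity⟩, hl, hs⟩)
  have hev : ∀ᶠ u in nhdsWithin (0 : ℝ) (Set.Ioi 0), 1 ≤ v u := by
    filter_upwards [nhdsWithin_le_nhds c1, nhdsWithin_le_nhds c2, nhdsWithin_le_nhds c3,
      self_mem_nhdsWithin] with u u1 u2 u3 u0
    simp only [lt_min_iff, Set.mem_Ioi] at u3 u0
    obtain ⟨⟨u4, u5⟩, u6, u7⟩ := u3
    obtain ⟨a, a1, a2⟩ := exists_pt hh p q u0.le u6.le
    obtain ⟨b, b1, b2⟩ := exists_pt hh p x u0.le u7.le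
    have hab := G a b (by linarith) (by linarith)
    rw [a1, b1, sub_self, abs_zero, dist_eq_zero] at hab
    subst hab
    have su : Real.sin (k * u) ≠ 0 := by
      apply (Real.sin_pos_of_pos_of_lt_pi (by positivity) _).ne'
      rw [lt_div_iff₀ hk] at u5; linarith
    have C := hX a p q x (dist_pos.1 (by linarith)) (dist_pos.1 (by linarith)).symm
      (dist_pos.1 (by linarith)).symm
    have d1 : dist p q = u + (dist p q - u) := by ring
    have d2 : dist x p = (dist p x - u) + u := by rw [dist_comm]; ring
    have e1 := cmp_pos_pi hκ su u1
    have e2 := cmp_pos_pi hκ u2 su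
    rw [← d1] at e1
    rw [← d2] at e2
    rw [dist_comm a p, a1, a2, b2, e1, e2, cmp_pos hκ] at C
    have e3 : Real.arccos (v u) = 0 := le_antisymm (by linarith) (Real.arccos_nonneg _)
    exact Real.arccos_eq_zero.1 e3
  have hlim := ge_of_tendsto (hv.tendsto.mono_left nhdsWithin_le_nhds) hev
  have : v 0 = (Real.cos (k * dist q x) - Real.cos (k * dist p q) *
    Real.cos (k * dist p x)) / (Real.sin (k * dist p q) * Real.sin (k * dist p x)) := by
    simp [v]
  rw [← this]; linarith

theorem crit_up {X : Type} [MetricSpace X] {n : ℕ} {κ : ℝ} (hX : IsAlexandrovSpace X n κ)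
    {h : X → X → X} (hh : IsHalf h) {p q : X} (hpq : p ≠ q)
    (hc : ∃ k0, ∀ k ≥ k0, IsCriticalPt κ ((h p)^[k] q) p) : IsCriticalPt κ q p := by
  have := hX.proper
  obtain ⟨k0, hk0⟩ := hc
  have hl : 0 < dist p q := dist_pos.2 hpq
  have hne : ∀ k, p ≠ (h p)^[k] q := by
    intro k
    apply dist_pos.1
    rw [dist_iter hh]; positivity
  have down : (∀ q m, dist p m = dist p q / 2 → dist m q = dist p q / 2 → p ≠ q →
      IsCriticalPt κ m p → IsCriticalPt κ q p) → IsCriticalPt κ q p := by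
    intro step
    have : ∀ j, IsCriticalPt κ ((h p)^[k0 - j] q) p := by
      intro j
      induction j with
      | zero => exact hk0 _ le_rfl
      | succ j ih =>
        rcases Nat.lt_or_ge j k0 with hj | hj
        · have e : k0 - j = (k0 - (j + 1)) + 1 := by omega
          rw [e, Function.iterate_succ_apply'] at ih
          exact step _ _ (hh _ _).1 (hh _ _).2 (hne _) ih
        · have e : k0 - (j + 1) = k0 - j := by omega
          rw [e]; exact ih
    simpa using this k0
  rcases lt_trichotomy κ 0 with hκ | rfl | hκ
  · exact down (fun q m h1 h2 h3 h4 => step_neg hκ hX.curv h1 h2 h3 h4)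
  · exact down (fun q m h1 h2 h3 h4 => step_zero hX.curv h1 h2 h3 h4)
  · by_cases hB : ∀ z, Real.sqrt κ * dist p z ≤ Real.pi
    · exact down (fun q m h1 h2 h3 h4 => step_pos hκ hX.curv h1 h2 h3 hB h4)
    · push Not at hB
      obtain ⟨z, hz⟩ := hB
      obtain ⟨w, η, hη0, hpw, hw, hη, G⟩ := caseA_near hκ hX.curv hh hz
      obtain ⟨k, hk⟩ := pow_unbounded_of_one_lt (dist p q / η) (show (1 : ℝ) < 2 by norm_num)
      rw [div_lt_iff₀ hη0] at hk
      have hlt : dist p ((h p)^[max k k0] q) < η := by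
        rw [dist_iter hh, div_lt_iff₀ (by positivity), mul_comm]
        have : (2 : ℝ) ^ k ≤ 2 ^ (max k k0) := pow_le_pow_right₀ (by norm_num) (le_max_left _ _)
        nlinarith
      have G2 := caseA_ray hκ hpw hw hη G (hne _) hlt (hk0 _ (le_max_right _ _))
      exact caseA_crit hκ hX.curv hh hη0 G2 hpq

end Collapse
namespace Collapse

lemma ext_crit {X : Type} [MetricSpace X] {n : ℕ} {κ : ℝ} (hX : IsAlexandrovSpace X n κ)
    {E : Set X} (hE : IsExtremal κ E) {p q : X} (hp : p ∈ E) (hpq : p ≠ q)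
    (hmin : IsLocalMinOn (fun x => dist q x) E p) : IsCriticalPt κ q p := by
  obtain ⟨h, hh⟩ := exists_half hX.midpoint
  have hl : 0 < dist p q := dist_pos.2 hpq
  have hmin' : ∀ᶠ x in nhdsWithin p E, dist q p ≤ dist q x := hmin
  obtain ⟨ε, hε, hball⟩ := Metric.eventually_nhds_iff.1 (eventually_nhdsWithin_iff.1 hmin')
  obtain ⟨k0, hk0⟩ := pow_unbounded_of_one_lt (dist p q / ε) (show (1 : ℝ) < 2 by norm_num)
  rw [div_lt_iff₀ hε] at hk0
  refine crit_up hX hh hpq ⟨k0, fun k hk => ?_⟩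
  have e1 := dist_iter hh p q k
  have e2 := iter_dist_le hh p q k
  have e3 : dist p q / 2 ^ k < ε := by
    rw [div_lt_iff₀ (by positivity), mul_comm]
    have : (2 : ℝ) ^ k0 ≤ 2 ^ k := pow_le_pow_right₀ (by norm_num) hk
    nlinarith
  have e4 : 0 < dist p q / 2 ^ k := by positivity
  set r := (h p)^[k] q
  apply hE.2 r _ p hp
  · change ∀ᶠ x in nhdsWithin p E, dist r p ≤ dist r x
    filter_upwards [hmin'] with x hx
    have := dist_triangle q r x
    rw [dist_comm q r] at this
    rw [dist_comm q p] at hx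
    rw [dist_comm r p]
    linarith
  · intro hr
    have := hball (y := r) (by rw [dist_comm]; linarith) hr
    rw [dist_comm q p, dist_comm q r] at this
    linarith

lemma ext_near {X : Type} [MetricSpace X] {n : ℕ} {κ : ℝ} (hX : IsAlexandrovSpace X n κ) (y : X) :
    ∃ ε > 0, ∀ F : Set X, IsExtremal κ F → (F ∩ ball y ε).Nonempty → y ∈ F := by
  have := hX.proper
  obtain ⟨ε, hε, H⟩ := no_crit hX y
  refine ⟨ε, hε, fun F hF hne => ?_⟩
  by_contra hy
  obtain ⟨x, hxF, hx⟩ := hne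
  obtain ⟨z, hz, hzd⟩ := hF.1.exists_infDist_eq_dist ⟨x, hxF⟩ y
  have hle : ∀ x ∈ F, dist y z ≤ dist y x := fun x hx => by
    rw [← hzd]; exact infDist_le_dist_of_mem hx
  have hyz : y ≠ z := by rintro rfl; exact hy hz
  refine H z (dist_pos.2 hyz) ?_ (hF.2 y hy z hz ?_)
  · rw [mem_ball, dist_comm] at hx
    exact (hle x hxF).trans_lt hx
  · change ∀ᶠ x in nhdsWithin z F, dist y z ≤ dist y x
    filter_upwards [self_mem_nhdsWithin] with x hx using hle x hx

lemma ext_sUnion {X : Type} [MetricSpace X] {n : ℕ} {κ : ℝ} (hX : IsAlexandrovSpace X n κ)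
    (𝓕 : Set (Set X)) (h𝓕 : ∀ F ∈ 𝓕, IsExtremal κ F) : IsExtremal κ (⋃₀ 𝓕) := by
  constructor
  · rw [← closure_subset_iff_isClosed]
    intro y hy
    obtain ⟨ε, hε, H⟩ := ext_near hX y
    obtain ⟨x, ⟨F, hF, hxF⟩, hx⟩ := Metric.mem_closure_iff.1 hy ε hε
    exact ⟨F, hF, H F (h𝓕 F hF) ⟨x, hxF, by rwa [mem_ball, dist_comm]⟩⟩
  · intro q hq p hp hmin
    obtain ⟨F, hF, hpF⟩ := hp
    refine (h𝓕 F hF).2 q (fun hqF => hq ⟨F, hF, hqF⟩) p hpF ?_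
    exact hmin.on_subset (subset_sUnion_of_mem hF)

lemma main_nonempty {X : Type} [MetricSpace X] {n : ℕ} {κ : ℝ} (hX : IsAlexandrovSpace X n κ)
    {E : Set X} (hE : IsPrimitiveExtremal κ E) (hne : E.Nonempty) : (mainPart κ E).Nonempty := by
  have := hX.proper
  have hEc : IsClosed E := hE.1.1
  have : Nonempty E := hne.to_subtype
  have : CompleteSpace E := hEc.completeSpace_coe
  obtain ⟨D, hDc, hDd⟩ := TopologicalSpace.exists_countable_dense E
  let G : E → Set X := fun y => ⋃₀ {F | IsExtremal κ F ∧ F ⊂ E ∧ (y : X) ∉ F}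
  have hG : ∀ y, IsExtremal κ (G y) := fun y => ext_sUnion hX _ (fun F hF => hF.1)
  have hGy : ∀ y : E, (y : X) ∉ G y := by
    rintro y ⟨F, hF, hy⟩; exact hF.2.2 hy
  have hGE : ∀ y, G y ⊂ E := fun y => ⟨sUnion_subset (fun F hF => hF.2.1.1), fun h => hGy y (h y.2)⟩
  have hdense : Dense (⋂ y ∈ D, (Subtype.val ⁻¹' (G y)ᶜ : Set E)) := by
    apply dense_biInter_of_isOpen
    · intro y _
      exact (hG y).1.isOpen_compl.preimage continuous_subtype_val
    · exact hDc
    · intro y _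
      rw [preimage_compl, ← interior_eq_empty_iff_dense_compl]
      obtain ⟨V, hV, hVe⟩ := isOpen_induced_iff.1 (isOpen_interior (s := (Subtype.val ⁻¹' (G y) : Set E)))
      have h1 := hE.2 (G y) (hG y) (hGE y) V hV (by
        rintro z ⟨hz, hzE⟩
        have : (⟨z, hzE⟩ : E) ∈ (Subtype.val ⁻¹' V : Set E) := hz
        rw [hVe] at this
        have h3 : (⟨z, hzE⟩ : E) ∈ (Subtype.val ⁻¹' (G y) : Set E) := interior_subset this
        exact h3)
      rw [← hVe]
      ext z
      simp only [mem_preimage, mem_empty_iff_false, iff_false]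
      intro hz
      have : (z : X) ∈ V ∩ E := ⟨hz, z.2⟩
      rw [h1] at this
      exact this
  obtain ⟨z, hz⟩ := hdense.nonempty
  refine ⟨z, z.2, ?_⟩
  rintro ⟨F, ⟨hF, hFE⟩, hzF⟩
  apply hFE.2
  have hDF : ∀ y ∈ D, (y : X) ∈ F := by
    intro y hy
    by_contra hyF
    have := mem_iInter₂.1 hz y hy
    exact this ⟨F, ⟨hF, hFE, hyF⟩, hzF⟩
  intro x hx
  have hcl : IsClosed (Subtype.val ⁻¹' F : Set E) := hF.1.preimage continuous_subtype_val
  have h2 : closure D ⊆ (Subtype.val ⁻¹' F : Set E) := hcl.closure_subset_iff.2 hDF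
  rw [hDd.closure_eq] at h2
  exact h2 (mem_univ ⟨x, hx⟩)

/-- The main part of a (nonempty) primitive extremal subset of an
Alexandrov space is connected. -/
theorem mainPart_connected (n : ℕ) (κ : ℝ) (X : Type) [MetricSpace X]
    (hX : IsAlexandrovSpace X n κ) (E : Set X) (hE : IsPrimitiveExtremal κ E)
    (hne : E.Nonempty) :
    IsConnected (mainPart κ E) := by
  refine ⟨main_nonempty hX hE hne, ?_⟩
  obtain ⟨S, hSdef⟩ : ∃ S, S = ⋃₀ {F : Set X | IsExtremal κ F ∧ F ⊂ E} := ⟨_, rfl⟩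
  have hS : IsExtremal κ S := by rw [hSdef]; exact ext_sUnion hX _ (fun F hF => hF.1)
  have hSE : S ⊆ E := by rw [hSdef]; exact sUnion_subset (fun F hF => hF.2.1)
  have hM : mainPart κ E = E \ S := by rw [hSdef]; rfl
  rw [hM]
  intro u v hu hv huv ⟨a, haE, hau⟩ ⟨b, hbE, hbv⟩
  by_contra hcon
  have hdisj : ∀ x ∈ E \ S, x ∈ u → x ∉ v := fun x hx hxu hxv => hcon ⟨x, hx, hxu, hxv⟩
  have hopen : IsOpen (Sᶜ ∩ v) := hS.1.isOpen_compl.inter hv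
  have hopen2 : IsOpen (u ∩ Sᶜ) := hu.inter hS.1.isOpen_compl
  have hVG : u ∩ Sᶜ ∩ E ⊆ E \ (Sᶜ ∩ v) := by
    rintro x ⟨⟨hxu, hxS⟩, hxE⟩
    exact ⟨hxE, fun hx => hdisj x ⟨hxE, hxS⟩ hxu hx.2⟩
  have hG : IsExtremal κ (E \ (Sᶜ ∩ v)) := by
    constructor
    · exact hE.1.1.sdiff hopen
    · intro q hq p hp hmin
      by_cases hpS : p ∈ S
      · have hsub : S ⊆ E \ (Sᶜ ∩ v) := fun x hx => ⟨hSE hx, fun h => h.1 hx⟩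
        exact hS.2 q (fun h => hq (hsub h)) p hpS (hmin.on_subset hsub)
      · have hpu : p ∈ u := by
          rcases huv ⟨hp.1, hpS⟩ with h | h
          · exact h
          · exact absurd ⟨hpS, h⟩ hp.2
        refine ext_crit hX hE.1 hp.1 (by rintro rfl; exact hq hp) ?_
        have hmin' : ∀ᶠ x in nhdsWithin p (E \ (Sᶜ ∩ v)), dist q p ≤ dist q x := hmin
        rw [eventually_nhdsWithin_iff] at hmin'
        change ∀ᶠ x in nhdsWithin p E, dist q p ≤ dist q x
        rw [eventually_nhdsWithin_iff]
        filter_upwards [hmin', hopen2.mem_nhds ⟨hpu, hpS⟩] with x h1 h2 h3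
        exact h1 (hVG ⟨h2, h3⟩)
  have hGE : E \ (Sᶜ ∩ v) ⊂ E := ⟨sdiff_subset, fun h => (h hbE.1).2 ⟨hbE.2, hbv⟩⟩
  have := hE.2 _ hG hGE (u ∩ Sᶜ) hopen2 hVG
  have ha : a ∈ u ∩ Sᶜ ∩ E := ⟨⟨hau, haE.2⟩, haE.1⟩
  rw [this] at ha
  exact ha

end Collapse
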